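/- arXiv:2511.04456 — 2 statements merged into one kernel-verified Lean document; each statement's English description precedes it below -/
import Mathlib

section
/- Under Assumptions 1–3, for the Fed-NSGDA-M iterates with global learning rates satisfying γ_x = γ_y/(10κ), the following inequality holds: (1/T) Σ_{t=0}^{T−1} E[‖∇Φ(x_t)‖] ≤ (Φ(x_0) − Φ*)/(γ_x T) + (Φ(x_0) − f(x_0,y_0))/(3γ_x T) + (10/3)(1/T) Σ_{t=0}^{T−1} E[‖∇_x f(x_t,y_t) − u_t‖] + (2 L_Φ γ_x)/3 + (20κ/3)(1/T) Σ_{t=0}^{T−1} E[‖∇_y f(x_t,y_t) − v_t‖] + L_f γ_x (1 + 10κ)²/6 + (5/3)·(1/(NpT)) Σ_{t=0}^{T−1} Σ_{n=1}^{N} Σ_{i=0}^{p−1} E[‖u_t − u^{(n)}_{t,i}‖] + (10κ/3)·(1/(NpT)) Σ_{t=0}^{T−1} Σ_{n=1}^{N} Σ_{i=0}^{p−1} E[‖v_t − v^{(n)}_{t,i}‖]. -/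
open MeasureTheory

section Smoothness

variable {E F : Type*} [NormedAddCommGroup E] [InnerProductSpace ℝ E]
  [NormedAddCommGroup F] [InnerProductSpace ℝ F]

/-- A function on `[0, 1]` whose derivative moves at most `K * t` away from its initial value is
within `K / 2` of its linear approximation. -/
lemma abs_sub_sub_deriv_le_of_deriv_dist_le {φ φ' : ℝ → ℝ} {K : ℝ}
    (hφ : ∀ t, HasDerivAt φ (φ' t) t) (hK : ∀ t, 0 ≤ t → |φ' t - φ' 0| ≤ K * t) :
    |φ 1 - φ 0 - φ' 0| ≤ K / 2 := by
  have hd : ∀ t, HasDerivAt (fun s => φ s - φ 0 - s * φ' 0) (φ' t - φ' 0) t := fun t => by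
    exact (((hφ t).sub_const (φ 0)).fun_sub ((hasDerivAt_id' t).mul_const (φ' 0))).congr_deriv
      (by ring)
  have hB : ∀ t, HasDerivAt (fun s : ℝ => K / 2 * s ^ 2) (K * t) t := fun t => by
    exact ((hasDerivAt_pow 2 t).const_mul (K / 2)).congr_deriv (by norm_num; ring)
  have h := image_norm_le_of_norm_deriv_right_le_deriv_boundary (a := 0) (b := 1)
    (f := fun s => φ s - φ 0 - s * φ' 0) (f' := fun t => φ' t - φ' 0)
    (B := fun s : ℝ => K / 2 * s ^ 2) (B' := fun t => K * t)
    (fun t _ => (hd t).continuousAt.continuousWithinAt)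
    (fun t _ => (hd t).hasDerivWithinAt) (by simp) hB
    (fun t ht => hK t ht.1) (x := 1) (by simp)
  simpa using h

lemma HasGradientAt.hasDerivAt_comp_add_smul [CompleteSpace E] {h : E → ℝ} {g x v : E} {t : ℝ}
    (hg : HasGradientAt h g (x + t • v)) :
    HasDerivAt (fun s : ℝ => h (x + s • v)) (inner ℝ g v) t := by
  have hl : HasDerivAt (fun s : ℝ => x + s • v) v t := by
    simpa using ((hasDerivAt_id t).smul_const v).const_add x
  exact (hg.hasFDerivAt.comp_hasDerivAt t hl).congr_deriv (by simp)

/-- Quadratic bound on the linearization error of a function with Lipschitz gradient. -/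
lemma abs_sub_sub_inner_gradient_le [CompleteSpace E] {h : E → ℝ} {G : E → E} {L : ℝ}
    (hG : ∀ x, HasGradientAt h (G x) x) (hL : ∀ x x', ‖G x - G x'‖ ≤ L * ‖x - x'‖) (x x' : E) :
    |h x' - h x - inner ℝ (G x) (x' - x)| ≤ L / 2 * ‖x' - x‖ ^ 2 := by
  have h1 := abs_sub_sub_deriv_le_of_deriv_dist_le
    (φ := fun s : ℝ => h (x + s • (x' - x)))
    (φ' := fun s : ℝ => inner ℝ (G (x + s • (x' - x))) (x' - x))
    (K := L * ‖x' - x‖ ^ 2) (fun t => (hG _).hasDerivAt_comp_add_smul) (fun t ht => by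
      rw [← inner_sub_left]
      refine (abs_real_inner_le_norm _ _).trans ?_
      have := hL (x + t • (x' - x)) (x + (0 : ℝ) • (x' - x))
      simp only [zero_smul, add_zero, add_sub_cancel_left, norm_smul, Real.norm_eq_abs,
        abs_of_nonneg ht] at this ⊢
      nlinarith [norm_nonneg (x' - x)])
  simp only [one_smul, zero_smul, add_zero, add_sub_cancel] at h1
  linarith

/-- A function bounded below by `m` lies above `m` by at least `‖∇h‖² / (2L)`. -/
lemma norm_gradient_sq_le_of_lower_bound [CompleteSpace E] {h : E → ℝ} {G : E → E} {L m : ℝ}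
    (hL0 : 0 < L)
    (hG : ∀ x, HasGradientAt h (G x) x) (hL : ∀ x x', ‖G x - G x'‖ ≤ L * ‖x - x'‖)
    (hm : ∀ x, m ≤ h x) (x : E) : ‖G x‖ ^ 2 ≤ 2 * L * (h x - m) := by
  have h1 := (abs_le.1 (abs_sub_sub_inner_gradient_le hG hL x (x - L⁻¹ • G x))).2
  have h2 := hm (x - L⁻¹ • G x)
  have h3 : x - L⁻¹ • G x - x = -(L⁻¹ • G x) := by abel
  rw [h3, inner_neg_right, real_inner_smul_right, real_inner_self_eq_norm_sq, norm_neg, norm_smul,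
    Real.norm_eq_abs, abs_of_pos (inv_pos.2 hL0)] at h1
  have h4 : L / 2 * (L⁻¹ * ‖G x‖) ^ 2 = L⁻¹ * ‖G x‖ ^ 2 / 2 := by field_simp
  have h5 : L⁻¹ * ‖G x‖ ^ 2 / 2 ≤ h x - m := by linarith
  have h6 : ‖G x‖ ^ 2 = 2 * L * (L⁻¹ * ‖G x‖ ^ 2 / 2) := by field_simp
  rw [h6]
  exact mul_le_mul_of_nonneg_left h5 (by positivity)

lemma inner_add_inner_le_sqrt_mul_sqrt (a u : E) (b v : F) :
    |inner ℝ a u + inner ℝ b v| ≤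
      √(‖a‖ ^ 2 + ‖b‖ ^ 2) * √(‖u‖ ^ 2 + ‖v‖ ^ 2) := by
  rw [← Real.sqrt_mul (by positivity)]
  apply Real.abs_le_sqrt
  have h1 := abs_real_inner_le_norm a u
  have h2 := abs_real_inner_le_norm b v
  have h3 : |inner ℝ a u + inner ℝ b v| ≤ ‖a‖ * ‖u‖ + ‖b‖ * ‖v‖ :=
    (abs_add_le _ _).trans (add_le_add h1 h2)
  rw [← sq_abs]
  nlinarith [abs_nonneg (inner ℝ a u + inner ℝ b v), sq_nonneg (‖a‖ * ‖v‖ - ‖b‖ * ‖u‖)]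

/-- Joint version of `abs_sub_sub_inner_gradient_le` for a function of two variables given by its
partial gradients. -/
lemma abs_sub_sub_inner_partial_gradients_le [CompleteSpace E] [CompleteSpace F]
    {h : E → F → ℝ} {Gx : E → F → E} {Gy : E → F → F} {L : ℝ} (hL0 : 0 ≤ L)
    (hGx : ∀ x y, HasGradientAt (fun x' => h x' y) (Gx x y) x)
    (hGy : ∀ x y, HasGradientAt (fun y' => h x y') (Gy x y) y)
    (hL : ∀ x y x' y', √(‖Gx x y - Gx x' y'‖ ^ 2 + ‖Gy x y - Gy x' y'‖ ^ 2) ≤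
      L * √(‖x - x'‖ ^ 2 + ‖y - y'‖ ^ 2)) (x x' : E) (y y' : F) :
    |h x' y' - h x y - (inner ℝ (Gx x y) (x' - x) + inner ℝ (Gy x y) (y' - y))| ≤
      L / 2 * (‖x' - x‖ ^ 2 + ‖y' - y‖ ^ 2) := by
  have hLx : ∀ x y x' y', ‖Gx x y - Gx x' y'‖ ≤ L * √(‖x - x'‖ ^ 2 + ‖y - y'‖ ^ 2) :=
    fun x y x' y' => (Real.le_sqrt_of_sq_le (by nlinarith [sq_nonneg ‖Gy x y - Gy x' y'‖])).trans
      (hL x y x' y')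
  have hLy : ∀ x y x' y', ‖Gy x y - Gy x' y'‖ ≤ L * √(‖x - x'‖ ^ 2 + ‖y - y'‖ ^ 2) :=
    fun x y x' y' => (Real.le_sqrt_of_sq_le (by nlinarith [sq_nonneg ‖Gx x y - Gx x' y'‖])).trans
      (hL x y x' y')
  -- a crude quadratic error bound, which gives differentiability along lines
  have crude : ∀ (x x' : E) (y y' : F),
      |h x' y' - h x y - (inner ℝ (Gx x y) (x' - x) + inner ℝ (Gy x y) (y' - y))| ≤
      L * (‖x' - x‖ + ‖y' - y‖) ^ 2 := by
    intro x x' y y'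
    have h1 := abs_le.1 (abs_sub_sub_inner_gradient_le (h := fun x' => h x' y')
      (G := fun x' => Gx x' y') (L := L) (fun x => hGx x y')
      (fun x x' => by simpa using hLx x y' x' y') x x')
    have h2 := abs_le.1 (abs_sub_sub_inner_gradient_le (h := fun y' => h x y')
      (G := fun y' => Gy x y') (L := L) (fun y => hGy x y)
      (fun y y' => by simpa using hLy x y x y') y y')
    have h3 : |inner ℝ (Gx x y' - Gx x y) (x' - x)| ≤ L * ‖y' - y‖ * ‖x' - x‖ :=
      (abs_real_inner_le_norm _ _).trans
        (mul_le_mul_of_nonneg_right (by simpa using hLx x y' x y) (norm_nonneg _))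
    rw [inner_sub_left] at h3
    have h3 := abs_le.1 h3
    have h4 : 0 ≤ L * ‖y' - y‖ * ‖x' - x‖ := by positivity
    have h5 : 0 ≤ L * ‖y' - y‖ ^ 2 := by positivity
    have h6 : 0 ≤ L * ‖x' - x‖ ^ 2 := by positivity
    rw [abs_le]
    constructor <;> nlinarith [h1.1, h1.2, h2.1, h2.2, h3.1, h3.2]
  set u := x' - x
  set v := y' - y
  have hd : ∀ t : ℝ, HasDerivAt (fun s : ℝ => h (x + s • u) (y + s • v))
      (inner ℝ (Gx (x + t • u) (y + t • v)) u + inner ℝ (Gy (x + t • u) (y + t • v)) v) t := by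
    intro t
    set c := inner ℝ (Gx (x + t • u) (y + t • v)) u + inner ℝ (Gy (x + t • u) (y + t • v)) v
    have hO : (fun s : ℝ => h (x + s • u) (y + s • v) - h (x + t • u) (y + t • v) - (s - t) * c)
        =O[nhds t] fun s => ‖s - t‖ ^ 2 := by
      refine Asymptotics.IsBigO.of_bound (L * (‖u‖ + ‖v‖) ^ 2) (Filter.Eventually.of_forall ?_)
      intro s
      have h1 := crude (x + t • u) (x + s • u) (y + t • v) (y + s • v)
      have e1 : x + s • u - (x + t • u) = (s - t) • u := by rw [sub_smul]; abel
      have e2 : y + s • v - (y + t • v) = (s - t) • v := by rw [sub_smul]; abel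
      rw [e1, e2, real_inner_smul_right, real_inner_smul_right, ← mul_add, norm_smul, norm_smul,
        ← mul_add, mul_pow] at h1
      rw [Real.norm_eq_abs, norm_pow, norm_norm]
      refine h1.trans (le_of_eq (by ring))
    have h0 := (hO.hasFDerivAt (by norm_num)).hasDerivAt
    have hlin : HasDerivAt (fun s : ℝ => (s - t) * c + h (x + t • u) (y + t • v)) c t := by
      simpa using (((hasDerivAt_id t).sub_const t).mul_const c).add_const
        (h (x + t • u) (y + t • v))
    refine ((h0.fun_add hlin).congr_deriv (by simp)).congr_of_eventuallyEq
      (Filter.Eventually.of_forall fun s => ?_)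
    ring
  have h1 := abs_sub_sub_deriv_le_of_deriv_dist_le (K := L * (‖u‖ ^ 2 + ‖v‖ ^ 2)) hd
    (fun t ht => by
      rw [add_sub_add_comm, ← inner_sub_left, ← inner_sub_left]
      refine (inner_add_inner_le_sqrt_mul_sqrt _ _ _ _).trans ?_
      have h2 := hL (x + t • u) (y + t • v) (x + (0 : ℝ) • u) (y + (0 : ℝ) • v)
      simp only [zero_smul, add_zero, add_sub_cancel_left, norm_smul, Real.norm_eq_abs,
        abs_of_nonneg ht] at h2 ⊢
      have e : √((t * ‖u‖) ^ 2 + (t * ‖v‖) ^ 2) = t * √(‖u‖ ^ 2 + ‖v‖ ^ 2) := by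
        rw [mul_pow, mul_pow, ← mul_add, Real.sqrt_mul (by positivity), Real.sqrt_sq ht]
      rw [e] at h2
      refine (mul_le_mul_of_nonneg_right h2 (Real.sqrt_nonneg _)).trans (le_of_eq ?_)
      have e2 := Real.mul_self_sqrt (by positivity : 0 ≤ ‖u‖ ^ 2 + ‖v‖ ^ 2)
      linear_combination L * t * e2)
  simp only [one_smul, zero_smul, add_zero] at h1
  have ex : x + u = x' := by simp [u]
  have ey : y + v = y' := by simp [v]
  rw [ex, ey] at h1
  linarith

end Smoothness

section PolyakLojasiewicz

variable {F : Type*} [NormedAddCommGroup F] [InnerProductSpace ℝ F]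

/-- Error bound for a function satisfying the Polyak-Lojasiewicz inequality: the distance to the
set of maximizers is at most `‖∇h‖ / μ`. -/
lemma exists_maximizer_dist_le_of_pl [ProperSpace F] [CompleteSpace F]
    {h : F → ℝ} {G : F → F} {m M : ℝ}
    (hm : 0 < m) (hG : ∀ y, HasGradientAt h (G y) y) (hM : ∀ y, h y ≤ M)
    (hPL : ∀ y, 2 * m * (M - h y) ≤ ‖G y‖ ^ 2) (y : F) :
    ∃ z, h z = M ∧ m * ‖z - y‖ ≤ ‖G y‖ := by
  have hcont : Continuous h := continuous_iff_continuousAt.2 fun y => (hG y).continuousAt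
  -- minimizing `√(M - h) + c ‖· - y‖` with `c` below the slope bound `√(m / 2)`
  have key : ∀ c : ℝ, 0 < c → 2 * c ^ 2 < m → ∃ z, h z = M ∧ c * ‖z - y‖ ≤ √(M - h y) := by
    intro c hc hcm
    have hψ : Continuous fun z => √(M - h z) + c * ‖z - y‖ := by fun_prop
    have htend : Filter.Tendsto (fun z => √(M - h z) + c * ‖z - y‖) (Filter.cocompact F)
        Filter.atTop := by
      refine Filter.tendsto_atTop_mono (f := fun z => c * ‖z - y‖)
        (fun z => by have := Real.sqrt_nonneg (M - h z); linarith) ?_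
      refine Filter.Tendsto.const_mul_atTop hc ?_
      simpa only [dist_eq_norm] using tendsto_dist_right_cocompact_atTop y
    obtain ⟨z, hz⟩ := hψ.exists_forall_le htend
    have hzM : h z = M := by
      by_contra hne
      have hlt : 0 < M - h z := sub_pos.2 (lt_of_le_of_ne (hM z) hne)
      set g := G z
      have hg2 : 2 * m * (M - h z) ≤ ‖g‖ ^ 2 := hPL z
      have hs := Real.sq_sqrt hlt.le
      have hs0 := Real.sqrt_pos.2 hlt
      have hder : HasDerivAt (fun s : ℝ => √(M - h (z + s • g)) + c * (s * ‖g‖))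
          (-(inner ℝ g g) / (2 * √(M - h z)) + c * ‖g‖) 0 := by
        have h1 : HasDerivAt (fun s : ℝ => h (z + s • g)) (inner ℝ g g) 0 :=
          HasGradientAt.hasDerivAt_comp_add_smul (by simpa using hG z)
        have h2 := (h1.const_sub M).sqrt (by simpa using hlt.ne')
        have h3 : HasDerivAt (fun s : ℝ => c * (s * ‖g‖)) (c * ‖g‖) 0 := by
          simpa using ((hasDerivAt_id (0 : ℝ)).mul_const ‖g‖).const_mul c
        exact (h2.fun_add h3).congr_deriv (by simp)
      have hnonneg : 0 ≤ -(inner ℝ g g) / (2 * √(M - h z)) + c * ‖g‖ := by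
        refine ge_of_tendsto (hasDerivWithinAt_iff_tendsto_slope' (s := Set.Ioi 0) (by simp)
          |>.1 hder.hasDerivWithinAt) ?_
        filter_upwards [self_mem_nhdsWithin] with s hs
        have hs : 0 < s := hs
        rw [slope_def_field]
        refine div_nonneg ?_ (by linarith)
        have h1 := hz (z + s • g)
        have h2 : ‖z + s • g - y‖ ≤ ‖z - y‖ + s * ‖g‖ := by
          calc ‖z + s • g - y‖ = ‖(z - y) + s • g‖ := by congr 1; abel
            _ ≤ _ := (norm_add_le _ _).trans (by rw [norm_smul, Real.norm_of_nonneg hs.le])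
        have h3 := mul_le_mul_of_nonneg_left h2 hc.le
        simp only [zero_smul, add_zero, zero_mul, mul_zero]
        nlinarith
      rw [real_inner_self_eq_norm_sq] at hnonneg
      have hg0 : 0 < ‖g‖ := by
        rcases (norm_nonneg g).eq_or_lt with h0 | h0
        · rw [← h0] at hg2; nlinarith [mul_pos hm hlt]
        · exact h0
      have h1 : ‖g‖ ^ 2 / (2 * √(M - h z)) ≤ c * ‖g‖ := by
        rw [neg_div] at hnonneg; linarith
      rw [div_le_iff₀ (by positivity)] at h1
      have h2 : ‖g‖ ≤ 2 * c * √(M - h z) := by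
        by_contra hcon
        push Not at hcon
        nlinarith [mul_lt_mul_of_pos_left hcon hg0]
      have h3 : ‖g‖ ^ 2 ≤ (2 * c * √(M - h z)) ^ 2 := pow_le_pow_left₀ hg0.le h2 2
      rw [mul_pow, hs] at h3
      nlinarith
    refine ⟨z, hzM, ?_⟩
    have := hz y
    simp only [hzM, sub_self, Real.sqrt_zero, norm_zero, mul_zero, add_zero, zero_add] at this
    exact this
  set S := {z | h z = M}
  have hSc : IsClosed S := isClosed_eq hcont continuous_const
  have hSne : S.Nonempty := by
    obtain ⟨z, hz, -⟩ := key (√(m / 4)) (by positivity)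
      (by rw [Real.sq_sqrt (by positivity)]; linarith)
    exact ⟨z, hz⟩
  obtain ⟨z, hzS, hz⟩ := hSc.exists_infDist_eq_dist hSne y
  refine ⟨z, hzS, ?_⟩
  have hlim : ∀ c : ℝ, 0 < c → c < √(m / 2) → c * dist y z ≤ √(M - h y) := by
    intro c hc hc2
    obtain ⟨w, hwS, hw⟩ := key c hc (by
      have := Real.lt_sqrt hc.le |>.1 hc2
      linarith)
    refine le_trans (mul_le_mul_of_nonneg_left ?_ hc.le) hw
    rw [← hz, ← dist_eq_norm, dist_comm w]
    exact Metric.infDist_le_dist_of_mem hwS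
  have hpos : 0 < √(m / 2) := by positivity
  have h1 : √(m / 2) * dist y z ≤ √(M - h y) := by
    refine le_of_tendsto (f := fun c : ℝ => c * dist y z) (x := nhdsWithin (√(m / 2))
      (Set.Iio (√(m / 2)))) ?_ ?_
    · exact (tendsto_nhdsWithin_of_tendsto_nhds
        ((continuous_id.mul continuous_const).tendsto _))
    · filter_upwards [Ioo_mem_nhdsLT hpos] with c hc using hlim c hc.1 hc.2
  rw [dist_comm, dist_eq_norm] at h1
  have h2 := pow_le_pow_left₀ (by positivity) h1 2
  rw [mul_pow, Real.sq_sqrt (by positivity), Real.sq_sqrt (sub_nonneg.2 (hM y))] at h2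
  refine abs_le_of_sq_le_sq' ?_ (norm_nonneg _) |>.2
  nlinarith [hPL y]

end PolyakLojasiewicz

section PrimalFunction

variable {E F : Type*} [NormedAddCommGroup E] [InnerProductSpace ℝ E] [CompleteSpace E]

/-- Envelope theorem: the gradient of the primal function is the partial gradient at any
maximizer. -/
lemma gradient_primal_eq {h : E → F → ℝ} {Phi : E → ℝ} {x g g' : E} {z : F}
    (hle : ∀ x' y, h x' y ≤ Phi x') (hz : h x z = Phi x)
    (hPhi : HasGradientAt Phi g x) (hh : HasGradientAt (fun x' => h x' z) g' x) : g = g' := by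
  have hmin : IsLocalMin (fun x' => Phi x' - h x' z) x :=
    Filter.Eventually.of_forall fun x' => by
      change Phi x - h x z ≤ Phi x' - h x' z
      linarith [hle x' z]
  have h0 := hmin.hasFDerivAt_eq_zero (hPhi.hasFDerivAt.fun_sub hh.hasFDerivAt)
  rw [← map_sub] at h0
  exact sub_eq_zero.1 ((InnerProductSpace.toDual ℝ E).map_eq_zero_iff.1 h0)

variable [NormedAddCommGroup F] [InnerProductSpace ℝ F] [ProperSpace F] [CompleteSpace F]
  {h : E → F → ℝ} {Gx : E → F → E} {Gy : E → F → F} {Phi : E → ℝ} {GPhi : E → E} {L m : ℝ}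

/-- The primal gradient differs from the partial gradient by at most `L / m` times the dual
gradient norm. -/
lemma norm_gradient_primal_sub_le (hL0 : 0 < L) (hm : 0 < m)
    (hGx : ∀ x y, HasGradientAt (fun x' => h x' y) (Gx x y) x)
    (hGy : ∀ x y, HasGradientAt (fun y' => h x y') (Gy x y) y)
    (hL : ∀ x y x' y', √(‖Gx x y - Gx x' y'‖ ^ 2 + ‖Gy x y - Gy x' y'‖ ^ 2) ≤
      L * √(‖x - x'‖ ^ 2 + ‖y - y'‖ ^ 2))
    (hle : ∀ x y, h x y ≤ Phi x) (hPL : ∀ x y, 2 * m * (Phi x - h x y) ≤ ‖Gy x y‖ ^ 2)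
    (hPhi : ∀ x, HasGradientAt Phi (GPhi x) x) (x : E) (y : F) :
    ‖GPhi x - Gx x y‖ ≤ L / m * ‖Gy x y‖ := by
  obtain ⟨z, hz, hzy⟩ := exists_maximizer_dist_le_of_pl hm (hGy x) (hle x) (hPL x) y
  rw [gradient_primal_eq hle hz (hPhi x) (hGx x z)]
  have h1 : ‖Gx x z - Gx x y‖ ≤ L * ‖z - y‖ :=
    (Real.le_sqrt_of_sq_le (by nlinarith [sq_nonneg ‖Gy x z - Gy x y‖])).trans
      ((hL x z x y).trans_eq (by simp))
  rw [div_mul_eq_mul_div, le_div_iff₀ hm]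
  nlinarith

/-- The primal gradient is Lipschitz with constant `L √(1 + (L / m)²)`. -/
lemma norm_gradient_primal_sub_gradient_primal_le (hL0 : 0 < L) (hm : 0 < m)
    (hGx : ∀ x y, HasGradientAt (fun x' => h x' y) (Gx x y) x)
    (hGy : ∀ x y, HasGradientAt (fun y' => h x y') (Gy x y) y)
    (hL : ∀ x y x' y', √(‖Gx x y - Gx x' y'‖ ^ 2 + ‖Gy x y - Gy x' y'‖ ^ 2) ≤
      L * √(‖x - x'‖ ^ 2 + ‖y - y'‖ ^ 2))
    (hle : ∀ x y, h x y ≤ Phi x) (hPL : ∀ x y, 2 * m * (Phi x - h x y) ≤ ‖Gy x y‖ ^ 2)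
    (hatt : ∀ x, ∃ y, h x y = Phi x)
    (hPhi : ∀ x, HasGradientAt Phi (GPhi x) x) (x x' : E) :
    ‖GPhi x - GPhi x'‖ ≤ L * √(1 + (L / m) ^ 2) * ‖x - x'‖ := by
  obtain ⟨y, hy⟩ := hatt x
  obtain ⟨z, hz, hzy⟩ := exists_maximizer_dist_le_of_pl hm (hGy x') (hle x') (hPL x') y
  have hy0 : Gy x y = 0 := by
    have hmax : IsLocalMax (fun y' => h x y') y :=
      Filter.Eventually.of_forall fun y' => (hle x y').trans hy.ge
    exact (InnerProductSpace.toDual ℝ F).map_eq_zero_iff.1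
      (hmax.hasFDerivAt_eq_zero (hGy x y).hasFDerivAt)
  rw [gradient_primal_eq hle hy (hPhi x) (hGx x y), gradient_primal_eq hle hz (hPhi x') (hGx x' z)]
  have h1 : ‖Gy x' y‖ ≤ L * ‖x' - x‖ := by
    have := hL x' y x y
    rw [hy0, sub_zero, sub_self, norm_zero] at this
    refine (Real.le_sqrt_of_sq_le ?_).trans (this.trans_eq (by simp))
    nlinarith [sq_nonneg ‖Gx x' y - Gx x y‖]
  have h2 : ‖y - z‖ ≤ L / m * ‖x - x'‖ := by
    rw [div_mul_eq_mul_div, le_div_iff₀ hm, norm_sub_rev y z, norm_sub_rev x x']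
    linarith
  have h3 : ‖Gx x y - Gx x' z‖ ≤ L * √(‖x - x'‖ ^ 2 + ‖y - z‖ ^ 2) :=
    (Real.le_sqrt_of_sq_le (by nlinarith [sq_nonneg ‖Gy x y - Gy x' z‖])).trans (hL x y x' z)
  refine h3.trans ?_
  rw [mul_assoc]
  refine mul_le_mul_of_nonneg_left ?_ hL0.le
  rw [← Real.sqrt_sq (norm_nonneg (x - x')), ← Real.sqrt_mul (by positivity),
    Real.sqrt_sq (norm_nonneg (x - x'))]
  refine Real.sqrt_le_sqrt ?_
  have := pow_le_pow_left₀ (norm_nonneg _) h2 2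
  rw [mul_pow] at this
  linarith

end PrimalFunction

section DegenerateDual

variable {E F : Type*} [NormedAddCommGroup E] [NormedAddCommGroup F] [InnerProductSpace ℝ F]
  [CompleteSpace F] {h : E → F → ℝ} {Gx : E → F → E} {Gy : E → F → F} {Phi : E → ℝ} {L m : ℝ}

/-- If the PL constant exceeds the smoothness constant, the objective does not depend on the dual
variable. -/
lemma eq_primal_of_lt (hL0 : 0 < L) (hLm : L < m)
    (hGy : ∀ x y, HasGradientAt (fun y' => h x y') (Gy x y) y)
    (hL : ∀ x y x' y', √(‖Gx x y - Gx x' y'‖ ^ 2 + ‖Gy x y - Gy x' y'‖ ^ 2) ≤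
      L * √(‖x - x'‖ ^ 2 + ‖y - y'‖ ^ 2))
    (hle : ∀ x y, h x y ≤ Phi x) (hPL : ∀ x y, 2 * m * (Phi x - h x y) ≤ ‖Gy x y‖ ^ 2)
    (x : E) (y : F) : h x y = Phi x := by
  have h1 := norm_gradient_sq_le_of_lower_bound (h := fun y => -h x y) (G := fun y => -Gy x y)
    (m := -Phi x) hL0
    (fun y => by
      rw [hasGradientAt_iff_hasFDerivAt, map_neg]
      exact (hGy x y).hasFDerivAt.fun_neg)
    (fun y y' => by
      rw [← norm_neg]
      refine (Real.le_sqrt_of_sq_le ?_).trans ((hL x y x y').trans_eq (by simp))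
      rw [neg_sub_neg, neg_sub]
      nlinarith [sq_nonneg ‖Gx x y - Gx x y'‖])
    (fun y => neg_le_neg (hle x y)) y
  rw [norm_neg] at h1
  have h2 := hPL x y
  have h3 := hle x y
  nlinarith

end DegenerateDual

section NormalizedDirections

variable {ι E : Type*} [NormedAddCommGroup E] [InnerProductSpace ℝ E]

lemma le_inner_normalized {w : E} (hw : w ≠ 0) (a : E) :
    ‖w‖ - ‖a - w‖ ≤ inner ℝ a (‖w‖⁻¹ • w) := by
  have hw0 : 0 < ‖w‖ := norm_pos_iff.2 hw
  have h1 : inner ℝ a w = ‖w‖ ^ 2 + inner ℝ (a - w) w := by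
    rw [inner_sub_left, real_inner_self_eq_norm_sq]; ring
  have h2 := (abs_le.1 (abs_real_inner_le_norm (a - w) w)).1
  rw [real_inner_smul_right, ← div_eq_inv_mul, le_div_iff₀ hw0]
  nlinarith

lemma norm_average_normalized_le_one (s : Finset ι) (w : ι → E) :
    ‖(s.card : ℝ)⁻¹ • ∑ i ∈ s, ‖w i‖⁻¹ • w i‖ ≤ 1 := by
  have h1 : ‖∑ i ∈ s, ‖w i‖⁻¹ • w i‖ ≤ s.card := by
    refine (norm_sum_le_of_le s (f := fun i => ‖w i‖⁻¹ • w i) (n := fun _ => 1) fun i _ => ?_).trans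
      (by simp)
    rw [norm_smul, norm_inv, norm_norm]
    exact inv_mul_le_one
  rw [norm_smul, norm_inv, Real.norm_natCast]
  rcases s.card.eq_zero_or_pos with h0 | h0
  · simp [h0]
  · exact inv_mul_le_one_of_le₀ h1 (by positivity)

/-- Lower bound on the alignment of a vector with an average of normalized vectors. -/
lemma le_inner_average_normalized {s : Finset ι} (hs : 0 < s.card) {w : ι → E}
    (hw : ∀ i ∈ s, w i ≠ 0) (a u : E) :
    ‖a‖ - 2 * ‖a - u‖ - 2 * ((s.card : ℝ)⁻¹ * ∑ i ∈ s, ‖u - w i‖) ≤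
      inner ℝ a ((s.card : ℝ)⁻¹ • ∑ i ∈ s, ‖w i‖⁻¹ • w i) := by
  have hc : (0 : ℝ) < s.card := by exact_mod_cast hs
  have h1 : ∑ i ∈ s, (‖a‖ - 2 * ‖a - u‖ - 2 * ‖u - w i‖) ≤ inner ℝ a (∑ i ∈ s, ‖w i‖⁻¹ • w i) := by
    rw [inner_sum]
    refine Finset.sum_le_sum fun i hi => le_trans ?_ (le_inner_normalized (hw i hi) a)
    have h2 := norm_sub_le_norm_sub_add_norm_sub a u (w i)
    have h3 : ‖a‖ ≤ ‖a - w i‖ + ‖w i‖ := by simpa using norm_add_le (a - w i) (w i)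
    linarith
  rw [Finset.sum_sub_distrib, Finset.sum_const, nsmul_eq_mul, ← Finset.mul_sum] at h1
  rw [real_inner_smul_right]
  have h2 := mul_le_mul_of_nonneg_left h1 (inv_nonneg.2 hc.le)
  refine le_trans (le_of_eq ?_) h2
  field_simp

/-- Sharper form of `le_inner_average_normalized` when the reference vector is the average. -/
lemma le_inner_average_normalized_of_average_eq {s : Finset ι} (hs : 0 < s.card) {w : ι → E}
    (hw : ∀ i ∈ s, w i ≠ 0) (a : E) {u : E} (hu : (s.card : ℝ)⁻¹ • ∑ i ∈ s, w i = u) :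
    ‖a‖ - 2 * ‖a - u‖ - (s.card : ℝ)⁻¹ * ∑ i ∈ s, ‖u - w i‖ ≤
      inner ℝ a ((s.card : ℝ)⁻¹ • ∑ i ∈ s, ‖w i‖⁻¹ • w i) := by
  have hc : (0 : ℝ) < s.card := by exact_mod_cast hs
  have h1 : ∑ i ∈ s, (‖w i‖ - ‖a - u‖ - ‖u - w i‖) ≤ inner ℝ a (∑ i ∈ s, ‖w i‖⁻¹ • w i) := by
    rw [inner_sum]
    refine Finset.sum_le_sum fun i hi => le_trans ?_ (le_inner_normalized (hw i hi) a)
    have h2 := norm_sub_le_norm_sub_add_norm_sub a u (w i)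
    linarith
  rw [Finset.sum_sub_distrib, Finset.sum_sub_distrib, Finset.sum_const, nsmul_eq_mul] at h1
  have h3 : ‖u‖ ≤ (s.card : ℝ)⁻¹ * ∑ i ∈ s, ‖w i‖ := by
    rw [← hu, norm_smul, norm_inv, Real.norm_natCast]
    exact mul_le_mul_of_nonneg_left (norm_sum_le _ _) (inv_nonneg.2 hc.le)
  have h4 : ‖a‖ ≤ ‖a - u‖ + ‖u‖ := by simpa using norm_add_le (a - u) u
  rw [real_inner_smul_right]
  have h2 := mul_le_mul_of_nonneg_left h1 (inv_nonneg.2 hc.le)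
  have h5 : (s.card : ℝ)⁻¹ * (s.card * ‖a - u‖) = ‖a - u‖ := by field_simp
  rw [mul_sub, mul_sub, h5] at h2
  linarith

/-- The server step obtained by averaging `p` normalized local steps of `N` clients. -/
lemma server_step_eq {N p : ℕ} {γ η c : ℝ} (hη : η ≠ 0) {z : Fin N → ℕ → E} {z₀ : E}
    {w : Fin N → ℕ → E} (h0 : ∀ n, z n 0 = z₀)
    (hS : ∀ n i, i < p → z n (i + 1) = z n i + (η * c * ‖w n i‖⁻¹) • w n i) :
    (γ / (η * N * p)) • ∑ n, (z n p - z₀) =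
      (γ * c) • (((Finset.univ ×ˢ Finset.range p : Finset (Fin N × ℕ)).card : ℝ)⁻¹ •
        ∑ q ∈ Finset.univ ×ˢ Finset.range p, ‖w q.1 q.2‖⁻¹ • w q.1 q.2) := by
  have h1 : ∀ n j, j ≤ p → z n j = z₀ + (η * c) • ∑ i ∈ Finset.range j, ‖w n i‖⁻¹ • w n i := by
    intro n j
    induction j with
    | zero => intro _; simp [h0]
    | succ j ih =>
      intro hj
      rw [hS n j (by omega), ih (by omega), Finset.sum_range_succ, smul_add, smul_smul, add_assoc]
  have h2 : ∀ n, z n p - z₀ = (η * c) • ∑ i ∈ Finset.range p, ‖w n i‖⁻¹ • w n i := fun n => by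
    rw [h1 n p le_rfl, add_sub_cancel_left]
  simp only [h2]
  rw [← Finset.smul_sum, Finset.sum_product, smul_smul, smul_smul]
  congr 1
  simp only [Finset.card_product, Finset.card_univ, Fintype.card_fin, Finset.card_range]
  push_cast
  rw [mul_inv]
  field_simp

end NormalizedDirections

section ScalarRecursions

lemma sum_le_of_potential {G e : ℕ → ℝ} {Ψ : ℕ → ℝ} {γ q r : ℝ}
    (h0 : γ * G 0 ≤ Ψ 0 - Ψ 1 + γ * e 0 + q + r)
    (hS : ∀ t, γ * G (t + 1) ≤ Ψ (t + 1) - Ψ (t + 2) + γ * e (t + 1) + q)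
    {T : ℕ} (hT : 0 < T) :
    γ * ∑ t ∈ Finset.range T, G t ≤
      Ψ 0 - Ψ T + γ * ∑ t ∈ Finset.range T, e t + T * q + r := by
  induction T, hT using Nat.le_induction with
  | base => simpa using h0
  | succ T hT ih =>
    obtain ⟨T, rfl⟩ : ∃ k, T = k + 1 := ⟨T - 1, by omega⟩
    rw [Finset.sum_range_succ, Finset.sum_range_succ _ (T + 1), mul_add, mul_add]
    have := hS T
    push_cast at ih ⊢
    linarith

/-- Summed gradient bound from the coupled primal and dual recursions, for condition number at
least one. The alignment of the first step may be weaker than that of the later ones. -/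
lemma sum_gradient_le_of_one_le_cond {Φ f G a H gm am bn A B C D : ℕ → ℝ} {γ L κ K Φs : ℝ}
    (hγ : 0 < γ) (hL : 0 < L) (hκ : 1 ≤ κ) (hK0 : 0 < K) (hK : K ≤ 17 / 12 * κ * L)
    (hΦ : ∀ t, Φ (t + 1) ≤ Φ t - γ * gm t + K / 2 * γ ^ 2)
    (hf : ∀ t, f t - γ * am t + 10 * κ * γ * bn t - L / 2 * (γ ^ 2 + (10 * κ * γ) ^ 2) ≤ f (t + 1))
    (hgap : ∀ t, |gm t - am t| ≤ κ * H t) (hGa : ∀ t, |G t - a t| ≤ κ * H t)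
    (hgm : ∀ t, -G t ≤ gm t) (ham : ∀ t, am t ≤ a t) (hbn : ∀ t, -H t ≤ bn t)
    (hH : ∀ t, 0 ≤ H t)
    (hA : ∀ t, 0 ≤ A t) (hB : ∀ t, 0 ≤ B t) (hC : ∀ t, 0 ≤ C t) (hD : ∀ t, 0 ≤ D t)
    (ha0 : a 0 - 2 * A 0 - 2 * C 0 ≤ am 0) (hH0 : H 0 - 2 * B 0 - 2 * D 0 ≤ bn 0)
    (haS : ∀ t, a (t + 1) - 2 * A (t + 1) - C (t + 1) ≤ am (t + 1))
    (hHS : ∀ t, H (t + 1) - 2 * B (t + 1) - D (t + 1) ≤ bn (t + 1))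
    (hfΦ : ∀ t, f t ≤ Φ t) (hlow : ∀ t, G t ^ 2 ≤ 2 * K * (Φ t - Φs))
    {T : ℕ} (hT : 0 < T) (hGT : G 0 - T * (K * γ) ≤ G T) :
    γ * ∑ t ∈ Finset.range T, G t ≤ Φ 0 - Φs + (Φ 0 - f 0) / 3
      + γ * ∑ t ∈ Finset.range T,
        (10 / 3 * A t + 20 * κ / 3 * B t + 5 / 3 * C t + 10 * κ / 3 * D t)
      + T * (γ ^ 2 * (2 * (L + L * κ) / 3 + L * (1 + 10 * κ) ^ 2 / 6)) := by
  have hκ0 : 0 < κ := by linarith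
  have hsum := sum_le_of_potential (Ψ := fun t => 9 / 7 * Φ t - 2 / 7 * f t) (G := G)
    (e := fun t => 10 / 3 * A t + 20 * κ / 3 * B t + 5 / 3 * C t + 10 * κ / 3 * D t)
    (q := γ ^ 2 * (9 / 14 * K + L * (1 + 100 * κ ^ 2) / 7)) (r := γ * (2 * G 0)) (γ := γ)
    (by
      have key : G 0 ≤ 9 / 7 * gm 0 - 2 / 7 * am 0 + 20 / 7 * (κ * bn 0) +
          (10 / 3 * A 0 + 20 * κ / 3 * B 0 + 5 / 3 * C 0 + 10 * κ / 3 * D 0) + 2 * G 0 := by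
        have h1 := (abs_le.1 (hgap 0)).1
        have h2 := mul_le_mul_of_nonneg_left hH0 hκ0.le
        have h3 := mul_le_mul_of_nonneg_left (hbn 0) hκ0.le
        have h4 := mul_nonneg hκ0.le (hB 0)
        have h5 := mul_nonneg hκ0.le (hH 0)
        linarith [hgm 0, ham 0, hA 0]
      have := mul_le_mul_of_nonneg_left key hγ.le
      linarith [hΦ 0, hf 0])
    (fun t => by
      have key : G (t + 1) ≤ 9 / 7 * gm (t + 1) - 2 / 7 * am (t + 1) + 20 / 7 * (κ * bn (t + 1)) +
          (10 / 3 * A (t + 1) + 20 * κ / 3 * B (t + 1) + 5 / 3 * C (t + 1) +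
            10 * κ / 3 * D (t + 1)) := by
        have h1 := (abs_le.1 (hgap (t + 1))).1
        have h2 := mul_le_mul_of_nonneg_left (hHS t) hκ0.le
        have h3 := (abs_le.1 (hGa (t + 1))).2
        have h4 := mul_nonneg hκ0.le (hB (t + 1))
        have h5 := mul_nonneg hκ0.le (hD (t + 1))
        have h6 := mul_nonneg hκ0.le (hH (t + 1))
        linarith [haS t, hA (t + 1), hC (t + 1)]
      have := mul_le_mul_of_nonneg_left key hγ.le
      linarith [hΦ (t + 1), hf (t + 1)]) hT
  have hT1 : (1 : ℝ) ≤ T := by exact_mod_cast hT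
  have hTpos : (0 : ℝ) < T := by linarith
  -- unused smoothness budget
  have hslack : 9 / 14 * K + L * (1 + 100 * κ ^ 2) / 7 + 4 * K ≤
      2 * (L + L * κ) / 3 + L * (1 + 10 * κ) ^ 2 / 6 := by
    nlinarith [mul_nonneg hL.le (sub_nonneg.2 hκ), mul_nonneg (mul_nonneg hL.le hκ0.le)
      (sub_nonneg.2 hκ)]
  have hq := mul_le_mul_of_nonneg_left hslack (by positivity : 0 ≤ T * γ ^ 2)
  have hfirst : 2 * (γ * G 0) ≤ Φ T - Φs + 4 * (T * (K * γ ^ 2)) := by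
    have h1 := hlow T
    have hw : 0 < K * γ := by positivity
    have h2 : 4 * (K * γ) * G 0 ≤ G T ^ 2 + 8 * T * (K * γ) ^ 2 := by
      rcases le_or_gt (G 0) (T * (K * γ)) with h | h
      · nlinarith [sq_nonneg (G T)]
      · have h3 : (G 0 - T * (K * γ)) ^ 2 ≤ G T ^ 2 := pow_le_pow_left₀ (by linarith) hGT 2
        nlinarith [sq_nonneg (G 0 - T * (K * γ) - 2 * (K * γ)), mul_pos hw hw]
    have h3 : 2 * K * (2 * (γ * G 0)) ≤ 2 * K * (Φ T - Φs + 4 * (T * (K * γ ^ 2))) := by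
      nlinarith
    exact le_of_mul_le_mul_left h3 (by positivity)
  linarith [hfΦ 0, hfΦ T]

/-- Summed gradient bound from the primal recursion alone. The alignment of the first step may be
weaker than that of the later ones. -/
lemma sum_gradient_le_of_primal_recursion {Φ G gm A C : ℕ → ℝ} {γ L Φs r₁ : ℝ}
    (hγ : 0 < γ) (hL : 0 < L)
    (hΦ : ∀ t, Φ (t + 1) ≤ Φ t - γ * gm t + L / 2 * γ ^ 2)
    (hΦ1 : Φ 1 ≤ Φ 0 - γ * r₁ + L / 2 * γ ^ 2) (hr₁ : r₁ ≤ gm 0 + L * γ)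
    (hgm : ∀ t, gm t ≤ G t) (hA : ∀ t, 0 ≤ A t) (hC : ∀ t, 0 ≤ C t)
    (h0 : G 0 - 2 * A 0 - 2 * C 0 ≤ gm 0)
    (hS : ∀ t, G (t + 1) - 2 * A (t + 1) - C (t + 1) ≤ gm (t + 1))
    (hlow : ∀ t, G t ^ 2 ≤ 2 * L * (Φ t - Φs))
    {T : ℕ} (hT : 0 < T) (hGT : (G 0 - r₁ - L * γ) / 2 - (T - 1) * (L * γ) ≤ G T) :
    γ * ∑ t ∈ Finset.range T, G t ≤ Φ 0 - Φs
      + γ * ∑ t ∈ Finset.range T, (10 / 3 * A t + 5 / 3 * C t)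
      + T * (γ ^ 2 * (5 / 6 * L)) := by
  have hw : 0 < L * γ := by positivity
  have hT1 : (1 : ℝ) ≤ T := by exact_mod_cast hT
  have hsum := sum_le_of_potential (Ψ := Φ) (G := G) (e := fun t => 10 / 3 * A t + 5 / 3 * C t)
    (q := γ ^ 2 * (L / 2)) (r := γ * (gm 0 + (G 0 - gm 0) / 6) - (Φ 0 - Φ 1)
      - γ ^ 2 * (L / 2)) (γ := γ)
    (by
      have key : G 0 ≤ (10 / 3 * A 0 + 5 / 3 * C 0) + gm 0 + (G 0 - gm 0) / 6 := by
        linarith [hA 0]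
      have := mul_le_mul_of_nonneg_left key hγ.le
      linarith)
    (fun t => by
      have key : G (t + 1) ≤ gm (t + 1) + (10 / 3 * A (t + 1) + 5 / 3 * C (t + 1)) := by
        linarith [hS t, hA (t + 1), hC (t + 1)]
      have := mul_le_mul_of_nonneg_left key hγ.le
      linarith [hΦ (t + 1)]) hT
  have hfirst : γ * (gm 0 + (G 0 - gm 0) / 6) - (Φ 0 - Φ 1) - γ ^ 2 * (L / 2) ≤
      Φ T - Φs + T * (γ ^ 2 * (L / 3)) := by
    have h1 := hlow T
    set P := (G 0 - gm 0) / 2 with hP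
    have hP0 : 0 ≤ P := by linarith [hgm 0]
    rcases le_or_gt r₁ (gm 0 + L * γ / 3) with h | h
    · have h2 : 2 * (L * γ) * P / 3 ≤ G T ^ 2 + 2 * T * (L * γ) ^ 2 / 3 := by
        rcases le_or_gt P (T * (L * γ)) with h' | h'
        · nlinarith [sq_nonneg (G T)]
        · have h3 : (P - T * (L * γ) + L * γ / 3) ^ 2 ≤ G T ^ 2 :=
            pow_le_pow_left₀ (by linarith) (by linarith) 2
          nlinarith
      have h3 : 2 * L * (γ * (P / 3)) ≤ 2 * L * (Φ T - Φs + T * (γ ^ 2 * (L / 3))) := by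
        nlinarith
      have h4 := le_of_mul_le_mul_left h3 (by positivity)
      rw [hP] at h4
      linarith [hΦ 0]
    · have h2 : 2 * (L * γ) * P / 3 ≤ G T ^ 2 + 2 * T * (L * γ) ^ 2 / 3 + 2 * (L * γ) ^ 2 / 3 := by
        rcases le_or_gt P (T * (L * γ)) with h' | h'
        · nlinarith [sq_nonneg (G T)]
        · have h3 : (P - T * (L * γ)) ^ 2 ≤ G T ^ 2 :=
            pow_le_pow_left₀ (by linarith) (by linarith) 2
          nlinarith [sq_nonneg (P - T * (L * γ) - L * γ)]
      have h3 : 2 * L * (γ * (P / 3)) ≤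
          2 * L * (Φ T - Φs + T * (γ ^ 2 * (L / 3)) + γ ^ 2 * (L / 3)) := by
        nlinarith
      have h4 := le_of_mul_le_mul_left h3 (by positivity)
      rw [hP] at h4
      have h5 := mul_lt_mul_of_pos_left h hγ
      linarith
  linarith

end ScalarRecursions

section Averages

variable {ι E F : Type*} [NormedAddCommGroup E] [NormedAddCommGroup F]

lemma HasGradientAt.const_mul_sum [InnerProductSpace ℝ E] [CompleteSpace E] {s : Finset ι}
    {h : ι → E → ℝ} {G : ι → E} {x : E} (c : ℝ) (hG : ∀ i ∈ s, HasGradientAt (h i) (G i) x) :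
    HasGradientAt (fun x' => c * ∑ i ∈ s, h i x') (c • ∑ i ∈ s, G i) x := by
  have h1 := (HasFDerivAt.fun_sum fun i hi => (hG i hi).hasFDerivAt).const_mul c
  rw [hasGradientAt_iff_hasFDerivAt]
  simpa using h1

lemma sqrt_norm_sq_add_norm_sq_sum_le (s : Finset ι) (a : ι → E) (b : ι → F) :
    √(‖∑ i ∈ s, a i‖ ^ 2 + ‖∑ i ∈ s, b i‖ ^ 2) ≤ ∑ i ∈ s, √(‖a i‖ ^ 2 + ‖b i‖ ^ 2) := by
  have h1 : ∀ (u : E) (v : F), ‖WithLp.toLp 2 (u, v)‖ = √(‖u‖ ^ 2 + ‖v‖ ^ 2) := fun u v => by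
    simp [WithLp.prod_norm_eq_of_L2]
  have h2 := norm_sum_le s fun i => WithLp.toLp 2 (a i, b i)
  rwa [← WithLp.toLp_sum, ← prod_mk_sum, h1, Finset.sum_congr rfl fun i _ => h1 (a i) (b i)] at h2

/-- Averages of maps that are jointly `L`-Lipschitz in the Euclidean sense are again so. -/
lemma sqrt_norm_average_sub_le [NormedSpace ℝ E] [NormedSpace ℝ F] {s : Finset ι}
    {c L r : ℝ} (hc : 0 ≤ c) (hcs : c * s.card = 1)
    {a a' : ι → E} {b b' : ι → F}
    (hL : ∀ i ∈ s, √(‖a i - a' i‖ ^ 2 + ‖b i - b' i‖ ^ 2) ≤ L * r) :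
    √(‖c • ∑ i ∈ s, a i - c • ∑ i ∈ s, a' i‖ ^ 2 + ‖c • ∑ i ∈ s, b i - c • ∑ i ∈ s, b' i‖ ^ 2) ≤
      L * r := by
  rw [← smul_sub, ← smul_sub, ← Finset.sum_sub_distrib, ← Finset.sum_sub_distrib, norm_smul,
    norm_smul, mul_pow, mul_pow, ← mul_add, Real.sqrt_mul (by positivity), Real.norm_of_nonneg hc,
    Real.sqrt_sq hc]
  have h1 := (sqrt_norm_sq_add_norm_sq_sum_le s (fun i => a i - a' i) fun i => b i - b' i).trans
    (Finset.sum_le_sum hL)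
  rw [Finset.sum_const, nsmul_eq_mul] at h1
  have h2 := mul_le_mul_of_nonneg_left h1 hc
  rwa [← mul_assoc, hcs, one_mul] at h2

end Averages

section Trajectory

lemma norm_sub_le_of_norm_step_le {E : Type*} [SeminormedAddCommGroup E] {x : ℕ → E} {γ : ℝ}
    (hx : ∀ t, ‖x (t + 1) - x t‖ ≤ γ) (k t : ℕ) : ‖x (k + t) - x k‖ ≤ t * γ := by
  induction t with
  | zero => simp
  | succ t ih =>
    have h1 := norm_sub_le_norm_sub_add_norm_sub (x (k + (t + 1))) (x (k + t)) (x k)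
    have h2 := hx (k + t)
    rw [← add_assoc] at h1 ⊢
    push_cast
    linarith

lemma abs_inner_le_norm_of_norm_le_one {E : Type*} [SeminormedAddCommGroup E]
    [InnerProductSpace ℝ E] (g : E) {v : E} (hv : ‖v‖ ≤ 1) : |inner ℝ g v| ≤ ‖g‖ :=
  (abs_real_inner_le_norm g v).trans (mul_le_of_le_one_right (norm_nonneg _) hv)

variable {E F : Type*} [NormedAddCommGroup E] [InnerProductSpace ℝ E] [CompleteSpace E]
  [NormedAddCommGroup F] [InnerProductSpace ℝ F] [ProperSpace F] [CompleteSpace F]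

/-- Bound on the summed primal gradient norms along a trajectory of approximately normalized
descent-ascent steps whose directions are aligned with the partial gradients, up to errors. -/
lemma sum_norm_gradient_primal_le
    {h : E → F → ℝ} {Gx : E → F → E} {Gy : E → F → F} {Phi : E → ℝ} {GPhi : E → E}
    {L m γ Φs : ℝ} (hL0 : 0 < L) (hm : 0 < m) (hγ : 0 < γ)
    (hGx : ∀ x y, HasGradientAt (fun x' => h x' y) (Gx x y) x)
    (hGy : ∀ x y, HasGradientAt (fun y' => h x y') (Gy x y) y)
    (hL : ∀ x y x' y', √(‖Gx x y - Gx x' y'‖ ^ 2 + ‖Gy x y - Gy x' y'‖ ^ 2) ≤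
      L * √(‖x - x'‖ ^ 2 + ‖y - y'‖ ^ 2))
    (hle : ∀ x y, h x y ≤ Phi x) (hPL : ∀ x y, 2 * m * (Phi x - h x y) ≤ ‖Gy x y‖ ^ 2)
    (hatt : ∀ x, ∃ y, h x y = Phi x) (hPhi : ∀ x, HasGradientAt Phi (GPhi x) x)
    (hΦs : ∀ x, Φs ≤ Phi x)
    {x d : ℕ → E} {y e : ℕ → F} {A B C D : ℕ → ℝ}
    (hx : ∀ t, x (t + 1) = x t - γ • d t)
    (hy : ∀ t, y (t + 1) = y t + (10 * (L / m) * γ) • e t)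
    (hd : ∀ t, ‖d t‖ ≤ 1) (he : ∀ t, ‖e t‖ ≤ 1)
    (hA : ∀ t, 0 ≤ A t) (hB : ∀ t, 0 ≤ B t) (hC : ∀ t, 0 ≤ C t) (hD : ∀ t, 0 ≤ D t)
    (hd0 : ‖Gx (x 0) (y 0)‖ - 2 * A 0 - 2 * C 0 ≤ inner ℝ (Gx (x 0) (y 0)) (d 0))
    (he0 : ‖Gy (x 0) (y 0)‖ - 2 * B 0 - 2 * D 0 ≤ inner ℝ (Gy (x 0) (y 0)) (e 0))
    (hdS : ∀ t, ‖Gx (x (t + 1)) (y (t + 1))‖ - 2 * A (t + 1) - C (t + 1) ≤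
      inner ℝ (Gx (x (t + 1)) (y (t + 1))) (d (t + 1)))
    (heS : ∀ t, ‖Gy (x (t + 1)) (y (t + 1))‖ - 2 * B (t + 1) - D (t + 1) ≤
      inner ℝ (Gy (x (t + 1)) (y (t + 1))) (e (t + 1)))
    {T : ℕ} (hT : 0 < T) :
    γ * ∑ t ∈ Finset.range T, ‖GPhi (x t)‖ ≤
      Phi (x 0) - Φs + (Phi (x 0) - h (x 0) (y 0)) / 3
      + γ * ∑ t ∈ Finset.range T,
        (10 / 3 * A t + 20 * (L / m) / 3 * B t + 5 / 3 * C t + 10 * (L / m) / 3 * D t)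
      + T * (γ ^ 2 * (2 * (L + L * (L / m)) / 3 + L * (1 + 10 * (L / m)) ^ 2 / 6)) := by
  have hκ0 : 0 < L / m := by positivity
  have hxsub : ∀ t, x (t + 1) - x t = -(γ • d t) := fun t => by rw [hx]; abel
  have hysub : ∀ t, y (t + 1) - y t = (10 * (L / m) * γ) • e t := fun t => by rw [hy]; abel
  have hxstep : ∀ t, ‖x (t + 1) - x t‖ ≤ γ := fun t => by
    rw [hxsub, norm_neg, norm_smul, Real.norm_of_nonneg hγ.le]
    exact mul_le_of_le_one_right hγ.le (hd t)
  have hystep : ∀ t, ‖y (t + 1) - y t‖ ≤ 10 * (L / m) * γ := fun t => by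
    rw [hysub, norm_smul, Real.norm_of_nonneg (by positivity)]
    exact mul_le_of_le_one_right (by positivity) (he t)
  have hdescent : ∀ {K : ℝ}, 0 < K → (∀ x x', ‖GPhi x - GPhi x'‖ ≤ K * ‖x - x'‖) →
      ∀ t, Phi (x (t + 1)) ≤ Phi (x t) - γ * inner ℝ (GPhi (x t)) (d t) + K / 2 * γ ^ 2 := by
    intro K hK hK' t
    have h1 := (abs_le.1 (abs_sub_sub_inner_gradient_le hPhi hK' (x t) (x (t + 1)))).2
    rw [hxsub, inner_neg_right, real_inner_smul_right, ← hxsub] at h1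
    have h2 := pow_le_pow_left₀ (norm_nonneg _) (hxstep t) 2
    have h3 := mul_le_mul_of_nonneg_left h2 (half_pos hK).le
    linarith
  rcases le_or_gt m L with hmL | hmL
  · have hκ : 1 ≤ L / m := (one_le_div hm).2 hmL
    have hK0 : 0 < 17 / 12 * (L / m) * L := by positivity
    have hK : ∀ x x', ‖GPhi x - GPhi x'‖ ≤ 17 / 12 * (L / m) * L * ‖x - x'‖ := fun x x' => by
      refine (norm_gradient_primal_sub_gradient_primal_le hL0 hm hGx hGy hL hle hPL hatt hPhi
        x x').trans (mul_le_mul_of_nonneg_right ?_ (norm_nonneg _))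
      rw [mul_comm L]
      refine mul_le_mul_of_nonneg_right (Real.sqrt_le_iff.2 ⟨by positivity, ?_⟩) hL0.le
      nlinarith
    have hprimal := norm_gradient_primal_sub_le hL0 hm hGx hGy hL hle hPL hPhi
    refine sum_gradient_le_of_one_le_cond (Φ := fun t => Phi (x t)) (f := fun t => h (x t) (y t))
      (G := fun t => ‖GPhi (x t)‖) (a := fun t => ‖Gx (x t) (y t)‖)
      (H := fun t => ‖Gy (x t) (y t)‖) (gm := fun t => inner ℝ (GPhi (x t)) (d t))
      (am := fun t => inner ℝ (Gx (x t) (y t)) (d t))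
      (bn := fun t => inner ℝ (Gy (x t) (y t)) (e t)) (K := 17 / 12 * (L / m) * L)
      hγ hL0 hκ hK0 le_rfl (hdescent hK0 hK) (fun t => ?_) (fun t => ?_) (fun t => ?_)
      (fun t => (abs_le.1 (abs_inner_le_norm_of_norm_le_one _ (hd t))).1)
      (fun t => (abs_le.1 (abs_inner_le_norm_of_norm_le_one _ (hd t))).2)
      (fun t => (abs_le.1 (abs_inner_le_norm_of_norm_le_one _ (he t))).1)
      (fun t => norm_nonneg _) hA hB hC hD
      hd0 he0 hdS heS (fun t => hle _ _)
      (fun t => norm_gradient_sq_le_of_lower_bound hK0 hPhi hK hΦs (x t)) hT ?_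
    · have h1 := (abs_le.1 (abs_sub_sub_inner_partial_gradients_le hL0.le hGx hGy hL
        (x t) (x (t + 1)) (y t) (y (t + 1)))).1
      rw [hxsub, inner_neg_right, real_inner_smul_right, ← hxsub, hysub, real_inner_smul_right,
        ← hysub] at h1
      have h2 := pow_le_pow_left₀ (norm_nonneg _) (hxstep t) 2
      have h3 := pow_le_pow_left₀ (norm_nonneg _) (hystep t) 2
      have h4 := mul_le_mul_of_nonneg_left (add_le_add h2 h3) (half_pos hL0).le
      linarith
    · rw [← inner_sub_left]
      exact (abs_inner_le_norm_of_norm_le_one _ (hd t)).trans (hprimal _ _)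
    · exact (abs_norm_sub_norm_le _ _).trans (hprimal _ _)
    · have h1 := norm_sub_le_of_norm_step_le hxstep 0 T
      rw [zero_add] at h1
      have h2 := (hK (x 0) (x T)).trans (mul_le_mul_of_nonneg_left
        ((norm_sub_rev _ _).trans_le h1) hK0.le)
      have h3 := norm_sub_norm_le (GPhi (x 0)) (GPhi (x T))
      linarith
  · have heq := eq_primal_of_lt hL0 hmL hGy hL hle hPL
    have hGeq : ∀ x y, GPhi x = Gx x y := fun x y =>
      gradient_primal_eq hle (heq x y) (hPhi x) (hGx x y)
    have hK : ∀ x x', ‖GPhi x - GPhi x'‖ ≤ L * ‖x - x'‖ := fun x' x'' => by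
      rw [hGeq x' (y 0), hGeq x'' (y 0)]
      refine (Real.le_sqrt_of_sq_le ?_).trans ((hL x' (y 0) x'' (y 0)).trans_eq (by simp))
      nlinarith [sq_nonneg ‖Gy x' (y 0) - Gy x'' (y 0)‖]
    have hstep1 : ‖GPhi (x 1) - GPhi (x 0)‖ ≤ L * γ :=
      (hK _ _).trans (mul_le_mul_of_nonneg_left (hxstep 0) hL0.le)
    have h1 := sum_gradient_le_of_primal_recursion (Φ := fun t => Phi (x t))
      (G := fun t => ‖GPhi (x t)‖) (gm := fun t => inner ℝ (GPhi (x t)) (d t)) (A := A) (C := C)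
      (r₁ := inner ℝ (GPhi (x 1)) (d 0)) (Φs := Φs) hγ hL0 (hdescent hL0 hK) (by
        have h1 := (abs_le.1 (abs_sub_sub_inner_gradient_le hPhi hK (x 1) (x 0))).1
        rw [← neg_sub, hxsub 0, neg_neg, real_inner_smul_right, norm_smul,
          Real.norm_of_nonneg hγ.le] at h1
        have h2 := pow_le_pow_left₀ (by positivity) (mul_le_of_le_one_right hγ.le (hd 0)) 2
        have h3 := mul_le_mul_of_nonneg_left h2 (half_pos hL0).le
        linarith) (by
        have h1 := (abs_le.1 (abs_inner_le_norm_of_norm_le_one (GPhi (x 1) - GPhi (x 0))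
          (hd 0))).2.trans hstep1
        rw [inner_sub_left] at h1
        linarith)
      (fun t => (abs_le.1 (abs_inner_le_norm_of_norm_le_one _ (hd t))).2) hA hC
      (by rw [hGeq _ (y 0)]; exact hd0) (fun t => by rw [hGeq _ (y (t + 1))]; exact hdS t)
      (fun t => norm_gradient_sq_le_of_lower_bound hL0 hPhi hK hΦs (x t)) hT (by
        have h1 := norm_sub_le_of_norm_step_le hxstep 1 (T - 1)
        rw [Nat.add_sub_cancel' hT, Nat.cast_sub hT, Nat.cast_one] at h1
        have h2 := (hK (x 1) (x T)).trans (mul_le_mul_of_nonneg_left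
          ((norm_sub_rev _ _).trans_le h1) hL0.le)
        have h3 := norm_sub_norm_le (GPhi (x 1)) (GPhi (x T))
        have h4 := (norm_sub_norm_le (GPhi (x 0)) (GPhi (x 1))).trans
          ((norm_sub_rev _ _).trans_le hstep1)
        have h5 := (abs_le.1 (abs_inner_le_norm_of_norm_le_one (GPhi (x 1)) (hd 0))).1
        linarith)
    have h2 : ∑ t ∈ Finset.range T, (10 / 3 * A t + 5 / 3 * C t) ≤ ∑ t ∈ Finset.range T,
        (10 / 3 * A t + 20 * (L / m) / 3 * B t + 5 / 3 * C t + 10 * (L / m) / 3 * D t) :=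
      Finset.sum_le_sum fun t _ => by
        have h3 := mul_nonneg hκ0.le (hB t)
        have h4 := mul_nonneg hκ0.le (hD t)
        linarith
    have h3 := mul_le_mul_of_nonneg_left h2 hγ.le
    have h4 : 5 / 6 * L ≤ 2 * (L + L * (L / m)) / 3 + L * (1 + 10 * (L / m)) ^ 2 / 6 := by
      have h5 := mul_pos hL0 hκ0
      nlinarith [mul_pos h5 hκ0]
    have h5 := mul_le_mul_of_nonneg_left h4 (by positivity : 0 ≤ T * γ ^ 2)
    rw [heq (x 0) (y 0)]
    linarith

end Trajectory

section Momenta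

variable {E : Type*} [NormedAddCommGroup E] [NormedSpace ℝ E]

/-- The control variates cancel in the average of the local momenta. -/
lemma average_corrected_momentum_eq {N p : ℕ} (hN : 0 < N) (hp : 0 < p) (β : ℝ)
    (D : Fin N → ℕ → E) (g : Fin N → E) (u : E) :
    ((Finset.univ ×ˢ Finset.range p : Finset (Fin N × ℕ)).card : ℝ)⁻¹ •
      ∑ q ∈ Finset.univ ×ˢ Finset.range p,
        (β • (D q.1 q.2 + (N : ℝ)⁻¹ • ∑ n, g n - g q.1) + (1 - β) • u) =
      β • ((N : ℝ)⁻¹ • ∑ n, (p : ℝ)⁻¹ • ∑ i ∈ Finset.range p, D n i) + (1 - β) • u := by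
  have hN' : (N : ℝ) ≠ 0 := by positivity
  have hp' : (p : ℝ) ≠ 0 := by positivity
  have h1 : ∑ q ∈ (Finset.univ ×ˢ Finset.range p : Finset (Fin N × ℕ)),
      (β • (D q.1 q.2 + (N : ℝ)⁻¹ • ∑ n, g n - g q.1) + (1 - β) • u) =
      β • ∑ n, ∑ i ∈ Finset.range p, D n i + ((N * p : ℝ) * (1 - β)) • u := by
    rw [Finset.sum_add_distrib, ← Finset.smul_sum, Finset.sum_sub_distrib, Finset.sum_add_distrib,
      Finset.sum_product, Finset.sum_product (f := fun q => g q.1), Finset.sum_const,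
      Finset.sum_const]
    simp only [Finset.sum_const, Finset.card_product, Finset.card_univ, Fintype.card_fin,
      Finset.card_range, ← Nat.cast_smul_eq_nsmul ℝ, ← Finset.smul_sum, smul_smul, Nat.cast_mul]
    rw [mul_right_comm, mul_inv_cancel₀ hN', one_mul, add_sub_cancel_right]
  rw [h1, ← Finset.smul_sum, smul_add, smul_smul, smul_smul, smul_smul, smul_smul]
  simp only [Finset.card_product, Finset.card_univ, Fintype.card_fin, Finset.card_range,
    Nat.cast_mul]
  congr 2 <;> field_simp

lemma integrable_global_momentum {Ω : Type*} {mΩ : MeasurableSpace Ω} {μ : Measure Ω} {β : ℝ}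
    {u g : ℕ → Ω → E} {u₀ : Ω → E} (hg : ∀ t, Integrable (g t) μ) (hu₀ : Integrable u₀ μ)
    (h0 : u 0 = fun ω => β • g 0 ω + (1 - β) • u₀ ω)
    (hS : ∀ t, u (t + 1) = fun ω => β • g (t + 1) ω + (1 - β) • u t ω) (t : ℕ) :
    Integrable (u t) μ := by
  induction t with
  | zero => rw [h0]; exact ((hg 0).smul β).add (hu₀.smul (1 - β))
  | succ t ih => rw [hS]; exact ((hg (t + 1)).smul β).add (ih.smul (1 - β))

lemma integrable_smul_sum {Ω : Type*} {mΩ : MeasurableSpace Ω} {μ : Measure Ω} {ι : Type*}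
    {D : ι → Ω → E} (s : Finset ι) (c : ℝ) (hD : ∀ i, Integrable (D i) μ) :
    Integrable (fun ω => c • ∑ i ∈ s, D i ω) μ :=
  (integrable_finsetSum s fun i _ => hD i).smul c

end Momenta

section Integration

variable {Ω : Type*} {mΩ : MeasurableSpace Ω} {μ : Measure Ω} [IsProbabilityMeasure μ]

lemma LipschitzWith.integrable_comp_of_dist_le {Z V : Type*} [PseudoMetricSpace Z]
    [NormedAddCommGroup V] {K : NNReal} {G : Z → V} (hG : LipschitzWith K G) {X : Ω → Z}
    (hX : StronglyMeasurable X) {z : Z} {R : ℝ} (hR : ∀ ω, dist (X ω) z ≤ R) :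
    Integrable (fun ω => G (X ω)) μ := by
  refine Integrable.of_bound (hG.continuous.comp_stronglyMeasurable hX).aestronglyMeasurable
    (‖G z‖ + K * R) (Filter.Eventually.of_forall fun ω => ?_)
  have h1 := (hG.dist_le_mul (X ω) z).trans (mul_le_mul_of_nonneg_left (hR ω) K.2)
  rw [dist_eq_norm] at h1
  have h2 := norm_sub_norm_le (G (X ω)) (G z)
  linarith

lemma lipschitzWith_uncurry_of_le_sqrt {E F V : Type*} [SeminormedAddCommGroup E]
    [SeminormedAddCommGroup F] [SeminormedAddCommGroup V] {G : E → F → V} {L : ℝ} (hL0 : 0 ≤ L)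
    (hL : ∀ x y x' y', ‖G x y - G x' y'‖ ≤ L * √(‖x - x'‖ ^ 2 + ‖y - y'‖ ^ 2)) :
    LipschitzWith (L * √2).toNNReal fun z : E × F => G z.1 z.2 := by
  refine LipschitzWith.of_dist_le_mul fun z z' => ?_
  rw [dist_eq_norm, Real.coe_toNNReal _ (by positivity), mul_assoc]
  refine (hL _ _ _ _).trans (mul_le_mul_of_nonneg_left ?_ hL0)
  rw [← Real.sqrt_sq (dist_nonneg (x := z) (y := z')), ← Real.sqrt_mul zero_le_two]
  refine Real.sqrt_le_sqrt ?_
  have h1 : ‖z.1 - z'.1‖ ≤ dist z z' := by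
    rw [← dist_eq_norm]; exact le_max_left _ _
  have h2 : ‖z.2 - z'.2‖ ≤ dist z z' := by
    rw [← dist_eq_norm]; exact le_max_right _ _
  have h3 := pow_le_pow_left₀ (norm_nonneg _) h1 2
  have h4 := pow_le_pow_left₀ (norm_nonneg _) h2 2
  linarith

lemma sum_integral_le_of_forall_sum_le {G A B C D : ℕ → Ω → ℝ} {γ c a b c' d : ℝ} {T : ℕ}
    (hG : ∀ t, Integrable (G t) μ) (hA : ∀ t, Integrable (A t) μ) (hB : ∀ t, Integrable (B t) μ)
    (hC : ∀ t, Integrable (C t) μ) (hD : ∀ t, Integrable (D t) μ)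
    (h : ∀ ω, γ * ∑ t ∈ Finset.range T, G t ω ≤ c + γ * ∑ t ∈ Finset.range T,
      (a * A t ω + b * B t ω + c' * C t ω + d * D t ω)) :
    γ * ∑ t ∈ Finset.range T, ∫ ω, G t ω ∂μ ≤ c + γ * (a * ∑ t ∈ Finset.range T, ∫ ω, A t ω ∂μ +
      b * ∑ t ∈ Finset.range T, ∫ ω, B t ω ∂μ + c' * ∑ t ∈ Finset.range T, ∫ ω, C t ω ∂μ +
      d * ∑ t ∈ Finset.range T, ∫ ω, D t ω ∂μ) := by
  have hsum : ∀ {X : ℕ → Ω → ℝ}, (∀ t, Integrable (X t) μ) →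
      Integrable (fun ω => ∑ t ∈ Finset.range T, X t ω) μ := fun hX =>
    integrable_finsetSum _ fun t _ => hX t
  have hAB : ∀ t, Integrable (fun ω => a * A t ω + b * B t ω) μ := fun t =>
    ((hA t).const_mul a).add ((hB t).const_mul b)
  have hABC : ∀ t, Integrable (fun ω => a * A t ω + b * B t ω + c' * C t ω) μ := fun t =>
    (hAB t).add ((hC t).const_mul c')
  have hE : ∀ t, Integrable (fun ω => a * A t ω + b * B t ω + c' * C t ω + d * D t ω) μ :=
    fun t => (hABC t).add ((hD t).const_mul d)
  have h1 := integral_mono ((hsum hG).const_mul γ)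
    ((integrable_const c).add ((hsum hE).const_mul γ)) h
  rw [integral_const_mul, integral_finsetSum _ fun t _ => hG t] at h1
  refine h1.trans_eq ?_
  rw [integral_add' (integrable_const c) ((hsum hE).const_mul γ), integral_const, probReal_univ,
    one_smul, integral_const_mul, integral_finsetSum _ fun t _ => hE t]
  congr 2
  rw [Finset.mul_sum, Finset.mul_sum, Finset.mul_sum, Finset.mul_sum, ← Finset.sum_add_distrib,
    ← Finset.sum_add_distrib, ← Finset.sum_add_distrib]
  refine Finset.sum_congr rfl fun t _ => ?_
  rw [integral_add (hABC t) ((hD t).const_mul d), integral_add (hAB t) ((hC t).const_mul c'),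
    integral_add ((hA t).const_mul a) ((hB t).const_mul b)]
  simp only [integral_const_mul]

end Integration

/-- core lemma bounding the average primal gradient norm of
Fed-NSGDA-M, Lemma 1 of the paper: under the smoothness, PL and heavy-tailed noise
assumptions, if `γₓ = γ_y/(10κ)` with `κ = L_f/μ`, then the average of
`E‖∇Φ(x_t)‖` over `T` rounds is bounded by initialization terms, the gradient
estimation errors, the consensus errors on momentum, and step-size terms. -/
theorem fed_nsgda_m_core_lemma
    {dx dy : ℕ} {Ω : Type} {mΩ : MeasurableSpace Ω}
    (μ : Measure Ω) [IsProbabilityMeasure μ]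
    (F : Filtration ℕ mΩ)
    (N p : ℕ) (hN : 0 < N) (hp : 0 < p)
    (Lf mupl sigma s : ℝ) (hLf : 0 < Lf) (hmupl : 0 < mupl) (hsigma : 0 < sigma)
    (hs1 : 1 < s) (hs2 : s ≤ 2)
    (gammax gammay etax etay betax betay : ℝ)
    (hgammax : 0 < gammax) (hgammay : 0 < gammay)
    (hetax : 0 < etax) (hetay : 0 < etay)
    (hbetax0 : 0 < betax) (hbetax1 : betax < 1)
    (hbetay0 : 0 < betay) (hbetay1 : betay < 1)
    -- Assumption 1 (smoothness): component losses, their partial gradients, and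
    -- joint `Lf`-Lipschitzness of the full gradients
    (f : Fin N → EuclideanSpace ℝ (Fin dx) → EuclideanSpace ℝ (Fin dy) → ℝ)
    (Gx : Fin N → EuclideanSpace ℝ (Fin dx) → EuclideanSpace ℝ (Fin dy) → EuclideanSpace ℝ (Fin dx))
    (Gy : Fin N → EuclideanSpace ℝ (Fin dx) → EuclideanSpace ℝ (Fin dy) → EuclideanSpace ℝ (Fin dy))
    (hGx : ∀ n x y, HasGradientAt (fun x' => f n x' y) (Gx n x y) x)
    (hGy : ∀ n x y, HasGradientAt (fun y' => f n x y') (Gy n x y) y)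
    (hLip : ∀ n x y x' y',
      Real.sqrt (‖Gx n x y - Gx n x' y'‖ ^ 2 + ‖Gy n x y - Gy n x' y'‖ ^ 2) ≤
        Lf * Real.sqrt (‖x - x'‖ ^ 2 + ‖y - y'‖ ^ 2))
    -- the global objective `f = (1/N) ∑ f⁽ⁿ⁾` and its partial gradients
    (fbar : EuclideanSpace ℝ (Fin dx) → EuclideanSpace ℝ (Fin dy) → ℝ)
    (hfbar : ∀ x y, fbar x y = (N : ℝ)⁻¹ * ∑ n, f n x y)
    (Gxbar : EuclideanSpace ℝ (Fin dx) → EuclideanSpace ℝ (Fin dy) → EuclideanSpace ℝ (Fin dx))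
    (hGxbar : ∀ x y, Gxbar x y = (N : ℝ)⁻¹ • ∑ n, Gx n x y)
    (Gybar : EuclideanSpace ℝ (Fin dx) → EuclideanSpace ℝ (Fin dy) → EuclideanSpace ℝ (Fin dy))
    (hGybar : ∀ x y, Gybar x y = (N : ℝ)⁻¹ • ∑ n, Gy n x y)
    -- Assumption 2 (PL condition in y, with maximizer selection `ystar`)
    (ystar : EuclideanSpace ℝ (Fin dx) → EuclideanSpace ℝ (Fin dy))
    (hystar : ∀ x y, fbar x y ≤ fbar x (ystar x))
    (hPL : ∀ x y, 2 * mupl * (fbar x (ystar x) - fbar x y) ≤ ‖Gybar x y‖ ^ 2)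
    -- the primal function Φ(x) = max_y f(x,y) and its gradient
    (Phi : EuclideanSpace ℝ (Fin dx) → ℝ)
    (hPhi : ∀ x, Phi x = fbar x (ystar x))
    (GPhi : EuclideanSpace ℝ (Fin dx) → EuclideanSpace ℝ (Fin dx))
    (hGPhi : ∀ x, HasGradientAt Phi (GPhi x) x)
    -- the random processes generated by Fed-NSGDA-M
    (xg : ℕ → Ω → EuclideanSpace ℝ (Fin dx)) (yg : ℕ → Ω → EuclideanSpace ℝ (Fin dy))
    (xl : Fin N → ℕ → ℕ → Ω → EuclideanSpace ℝ (Fin dx))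
    (yl : Fin N → ℕ → ℕ → Ω → EuclideanSpace ℝ (Fin dy))
    (ul : Fin N → ℕ → ℕ → Ω → EuclideanSpace ℝ (Fin dx))
    (vl : Fin N → ℕ → ℕ → Ω → EuclideanSpace ℝ (Fin dy))
    (ug : ℕ → Ω → EuclideanSpace ℝ (Fin dx)) (vg : ℕ → Ω → EuclideanSpace ℝ (Fin dy))
    (Dx : Fin N → ℕ → ℕ → Ω → EuclideanSpace ℝ (Fin dx))
    (Dy : Fin N → ℕ → ℕ → Ω → EuclideanSpace ℝ (Fin dy))
    (gxl : Fin N → ℕ → Ω → EuclideanSpace ℝ (Fin dx))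
    (gyl : Fin N → ℕ → Ω → EuclideanSpace ℝ (Fin dy))
    (gxg : ℕ → Ω → EuclideanSpace ℝ (Fin dx)) (gyg : ℕ → Ω → EuclideanSpace ℝ (Fin dy))
    (uinit : Ω → EuclideanSpace ℝ (Fin dx)) (vinit : Ω → EuclideanSpace ℝ (Fin dy))
    (gxinit : Ω → EuclideanSpace ℝ (Fin dx)) (gyinit : Ω → EuclideanSpace ℝ (Fin dy))
    (gxlinit : Fin N → Ω → EuclideanSpace ℝ (Fin dx))
    (gylinit : Fin N → Ω → EuclideanSpace ℝ (Fin dy))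
    (x0 : EuclideanSpace ℝ (Fin dx)) (y0 : EuclideanSpace ℝ (Fin dy))
    (hx0 : xg 0 = fun _ => x0) (hy0 : yg 0 = fun _ => y0)
    (hminit : StronglyMeasurable uinit ∧ StronglyMeasurable vinit ∧
      StronglyMeasurable gxinit ∧ StronglyMeasurable gyinit ∧
      (∀ n, StronglyMeasurable (gxlinit n)) ∧ (∀ n, StronglyMeasurable (gylinit n)))
    (hinitint : Integrable uinit μ ∧ Integrable vinit μ ∧ Integrable gxinit μ ∧
      Integrable gyinit μ ∧ (∀ n, Integrable (gxlinit n) μ) ∧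
      (∀ n, Integrable (gylinit n) μ))
    -- algorithm dynamics: local normalized updates
    (hxl0 : ∀ n t, xl n t 0 = xg t) (hyl0 : ∀ n t, yl n t 0 = yg t)
    (hulnz : ∀ n t i ω, ul n t i ω ≠ 0) (hvlnz : ∀ n t i ω, vl n t i ω ≠ 0)
    (hxlS : ∀ n t i, i < p →
      xl n t (i + 1) = fun ω => xl n t i ω - (etax * ‖ul n t i ω‖⁻¹) • ul n t i ω)
    (hylS : ∀ n t i, i < p →
      yl n t (i + 1) = fun ω => yl n t i ω + (etay * ‖vl n t i ω‖⁻¹) • vl n t i ω)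
    -- local momenta with control variates (round 0 uses the initial values)
    (hul0 : ∀ n i, ul n 0 i =
      fun ω => betax • (Dx n 0 i ω + gxinit ω - gxlinit n ω) + (1 - betax) • uinit ω)
    (hulS : ∀ n t i, ul n (t + 1) i =
      fun ω => betax • (Dx n (t + 1) i ω + gxg t ω - gxl n t ω) + (1 - betax) • ug t ω)
    (hvl0 : ∀ n i, vl n 0 i =
      fun ω => betay • (Dy n 0 i ω + gyinit ω - gylinit n ω) + (1 - betay) • vinit ω)
    (hvlS : ∀ n t i, vl n (t + 1) i =
      fun ω => betay • (Dy n (t + 1) i ω + gyg t ω - gyl n t ω) + (1 - betay) • vg t ω)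
    -- control variates
    (hgxl : ∀ n t, gxl n t = fun ω => (p : ℝ)⁻¹ • ∑ i ∈ Finset.range p, Dx n t i ω)
    (hgyl : ∀ n t, gyl n t = fun ω => (p : ℝ)⁻¹ • ∑ i ∈ Finset.range p, Dy n t i ω)
    (hgxg : ∀ t, gxg t = fun ω => (N : ℝ)⁻¹ • ∑ n, gxl n t ω)
    (hgyg : ∀ t, gyg t = fun ω => (N : ℝ)⁻¹ • ∑ n, gyl n t ω)
    -- global updates and global momenta
    (hxgS : ∀ t, xg (t + 1) =
      fun ω => xg t ω + (gammax / (etax * N * p)) • ∑ n, (xl n t p ω - xg t ω))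
    (hygS : ∀ t, yg (t + 1) =
      fun ω => yg t ω + (gammay / (etay * N * p)) • ∑ n, (yl n t p ω - yg t ω))
    (hug0 : ug 0 = fun ω => betax • gxg 0 ω + (1 - betax) • uinit ω)
    (hugS : ∀ t, ug (t + 1) = fun ω => betax • gxg (t + 1) ω + (1 - betax) • ug t ω)
    (hvg0 : vg 0 = fun ω => betay • gyg 0 ω + (1 - betay) • vinit ω)
    (hvgS : ∀ t, vg (t + 1) = fun ω => betay • gyg (t + 1) ω + (1 - betay) • vg t ω)
    -- Assumption 3 (heavy-tailed noise): the stochastic gradients are integrable,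
    -- adapted to the filtration indexed lexicographically by (round, local step,
    -- client), conditionally unbiased, and have bounded s-th noise moment
    (hDxint : ∀ n t i, Integrable (Dx n t i) μ)
    (hDyint : ∀ n t i, Integrable (Dy n t i) μ)
    (hDxadapt : ∀ (n : Fin N) (t i : ℕ),
      StronglyMeasurable[F ((t * p + i) * N + (n : ℕ) + 1)] (Dx n t i))
    (hDyadapt : ∀ (n : Fin N) (t i : ℕ),
      StronglyMeasurable[F ((t * p + i) * N + (n : ℕ) + 1)] (Dy n t i))
    (hiteradapt : ∀ (n : Fin N) (t i : ℕ),
      StronglyMeasurable[F ((t * p + i) * N)] (xl n t i) ∧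
      StronglyMeasurable[F ((t * p + i) * N)] (yl n t i))
    (hunbx : ∀ (n : Fin N) (t i : ℕ),
      μ[fun ω => Dx n t i ω - Gx n (xl n t i ω) (yl n t i ω)|F ((t * p + i) * N + (n : ℕ))]
        =ᵐ[μ] 0)
    (hunby : ∀ (n : Fin N) (t i : ℕ),
      μ[fun ω => Dy n t i ω - Gy n (xl n t i ω) (yl n t i ω)|F ((t * p + i) * N + (n : ℕ))]
        =ᵐ[μ] 0)
    (hmomx : ∀ (n : Fin N) (t i : ℕ),
      ∫ ω, ‖Dx n t i ω - Gx n (xl n t i ω) (yl n t i ω)‖ ^ s ∂μ ≤ sigma ^ s)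
    (hmomy : ∀ (n : Fin N) (t i : ℕ),
      ∫ ω, ‖Dy n t i ω - Gy n (xl n t i ω) (yl n t i ω)‖ ^ s ∂μ ≤ sigma ^ s)
    (PhiStar : ℝ) (hPhiStar : IsGLB (Set.range Phi) PhiStar)
    (T : ℕ) (hT : 0 < T)
    (hratio : gammax = gammay / (10 * (Lf / mupl))) :
    ((1 : ℝ) / T) * ∑ t ∈ Finset.range T, ∫ ω, ‖GPhi (xg t ω)‖ ∂μ ≤
      (Phi x0 - PhiStar) / (gammax * T)
      + (Phi x0 - fbar x0 y0) / (3 * gammax * T)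
      + (10 / 3) * (((1 : ℝ) / T) *
          ∑ t ∈ Finset.range T, ∫ ω, ‖Gxbar (xg t ω) (yg t ω) - ug t ω‖ ∂μ)
      + 2 * (Lf + Lf ^ 2 / mupl) * gammax / 3
      + (20 * (Lf / mupl) / 3) * (((1 : ℝ) / T) *
          ∑ t ∈ Finset.range T, ∫ ω, ‖Gybar (xg t ω) (yg t ω) - vg t ω‖ ∂μ)
      + Lf * gammax * (1 + 10 * (Lf / mupl)) ^ 2 / 6
      + (5 / 3) * (((1 : ℝ) / (N * p * T)) * ∑ t ∈ Finset.range T, ∑ n : Fin N,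
          ∑ i ∈ Finset.range p, ∫ ω, ‖ug t ω - ul n t i ω‖ ∂μ)
      + (10 * (Lf / mupl) / 3) * (((1 : ℝ) / (N * p * T)) * ∑ t ∈ Finset.range T,
          ∑ n : Fin N, ∑ i ∈ Finset.range p, ∫ ω, ‖vg t ω - vl n t i ω‖ ∂μ) := by
  have hN0 : (0 : ℝ) < N := by exact_mod_cast hN
  have hp0 : (0 : ℝ) < p := by exact_mod_cast hp
  have hT0 : (0 : ℝ) < T := by exact_mod_cast hT
  have hκ0 : 0 < Lf / mupl := by positivity
  have hgy : gammay = 10 * (Lf / mupl) * gammax := by rw [hratio]; field_simp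
  -- the averaged objective
  have hGxb : ∀ x y, HasGradientAt (fun x' => fbar x' y) (Gxbar x y) x := fun x y => by
    simp only [hfbar, hGxbar]
    exact HasGradientAt.const_mul_sum _ fun n _ => hGx n x y
  have hGyb : ∀ x y, HasGradientAt (fun y' => fbar x y') (Gybar x y) y := fun x y => by
    simp only [hfbar, hGybar]
    exact HasGradientAt.const_mul_sum _ fun n _ => hGy n x y
  have hLb : ∀ x y x' y', √(‖Gxbar x y - Gxbar x' y'‖ ^ 2 + ‖Gybar x y - Gybar x' y'‖ ^ 2) ≤
      Lf * √(‖x - x'‖ ^ 2 + ‖y - y'‖ ^ 2) := fun x y x' y' => by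
    simp only [hGxbar, hGybar]
    exact sqrt_norm_average_sub_le (by positivity) (by simp [hN0.ne']) fun n _ =>
      hLip n x y x' y'
  have hle : ∀ x y, fbar x y ≤ Phi x := fun x y => (hystar x y).trans_eq (hPhi x).symm
  have hPL' : ∀ x y, 2 * mupl * (Phi x - fbar x y) ≤ ‖Gybar x y‖ ^ 2 := fun x y => by
    rw [hPhi]; exact hPL x y
  have hatt : ∀ x, ∃ y, fbar x y = Phi x := fun x => ⟨ystar x, (hPhi x).symm⟩
  -- the server steps
  set S : Finset (Fin N × ℕ) := Finset.univ ×ˢ Finset.range p with hS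
  have hcard : (S.card : ℝ) = N * p := by simp [hS]
  have hcard0 : 0 < S.card := by simp [hS, hN, hp]
  set d : ℕ → Ω → EuclideanSpace ℝ (Fin dx) := fun t ω =>
    (S.card : ℝ)⁻¹ • ∑ q ∈ S, ‖ul q.1 t q.2 ω‖⁻¹ • ul q.1 t q.2 ω with hd
  set e : ℕ → Ω → EuclideanSpace ℝ (Fin dy) := fun t ω =>
    (S.card : ℝ)⁻¹ • ∑ q ∈ S, ‖vl q.1 t q.2 ω‖⁻¹ • vl q.1 t q.2 ω with he
  have hd1 : ∀ t ω, ‖d t ω‖ ≤ 1 := fun t ω => norm_average_normalized_le_one S _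
  have he1 : ∀ t ω, ‖e t ω‖ ≤ 1 := fun t ω => norm_average_normalized_le_one S _
  have hxstep : ∀ t ω, xg (t + 1) ω = xg t ω - gammax • d t ω := fun t ω => by
    have h1 := server_step_eq (γ := gammax) (c := -1) (p := p) hetax.ne'
      (z := fun n i => xl n t i ω) (z₀ := xg t ω) (w := fun n i => ul n t i ω)
      (fun n => by rw [hxl0]) (fun n i hi => by
        simp only [hxlS n t i hi, mul_neg_one, neg_mul, neg_smul, sub_eq_add_neg])
    simp only [hxgS]
    rw [h1, mul_neg_one, neg_smul, ← sub_eq_add_neg]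
  have hystep : ∀ t ω, yg (t + 1) ω = yg t ω + gammay • e t ω := fun t ω => by
    have h1 := server_step_eq (γ := gammay) (c := 1) (p := p) hetay.ne'
      (z := fun n i => yl n t i ω) (z₀ := yg t ω) (w := fun n i => vl n t i ω)
      (fun n => by rw [hyl0]) (fun n i hi => by simp only [hylS n t i hi, mul_one])
    simp only [hygS]
    rw [h1, mul_one]
  -- after the first round, the local momenta average to the global one
  have huavg : ∀ t ω, (S.card : ℝ)⁻¹ • ∑ q ∈ S, ul q.1 (t + 1) q.2 ω = ug (t + 1) ω := by
    intro t ω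
    simp only [hulS, hugS t, hgxg, hgxl _ (t + 1)]
    exact average_corrected_momentum_eq hN hp betax (fun n i => Dx n (t + 1) i ω)
      (fun n => gxl n t ω) (ug t ω)
  have hvavg : ∀ t ω, (S.card : ℝ)⁻¹ • ∑ q ∈ S, vl q.1 (t + 1) q.2 ω = vg (t + 1) ω := by
    intro t ω
    simp only [hvlS, hvgS t, hgyg, hgyl _ (t + 1)]
    exact average_corrected_momentum_eq hN hp betay (fun n i => Dy n (t + 1) i ω)
      (fun n => gyl n t ω) (vg t ω)
  set C : ℕ → Ω → ℝ := fun t ω => (S.card : ℝ)⁻¹ * ∑ q ∈ S, ‖ug t ω - ul q.1 t q.2 ω‖ with hC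
  set D : ℕ → Ω → ℝ := fun t ω => (S.card : ℝ)⁻¹ * ∑ q ∈ S, ‖vg t ω - vl q.1 t q.2 ω‖ with hD
  have hC0 : ∀ t ω, 0 ≤ C t ω := fun t ω =>
    mul_nonneg (inv_nonneg.2 (Nat.cast_nonneg _)) (Finset.sum_nonneg fun q _ => norm_nonneg _)
  have hD0 : ∀ t ω, 0 ≤ D t ω := fun t ω =>
    mul_nonneg (inv_nonneg.2 (Nat.cast_nonneg _)) (Finset.sum_nonneg fun q _ => norm_nonneg _)
  have hpath : ∀ ω, gammax * ∑ t ∈ Finset.range T, ‖GPhi (xg t ω)‖ ≤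
      (Phi x0 - PhiStar + (Phi x0 - fbar x0 y0) / 3 + T * (gammax ^ 2 *
        (2 * (Lf + Lf * (Lf / mupl)) / 3 + Lf * (1 + 10 * (Lf / mupl)) ^ 2 / 6)))
      + gammax * ∑ t ∈ Finset.range T, (10 / 3 * ‖Gxbar (xg t ω) (yg t ω) - ug t ω‖
        + 20 * (Lf / mupl) / 3 * ‖Gybar (xg t ω) (yg t ω) - vg t ω‖
        + 5 / 3 * C t ω + 10 * (Lf / mupl) / 3 * D t ω) := fun ω => by
    have h1 := sum_norm_gradient_primal_le (x := fun t => xg t ω) (y := fun t => yg t ω)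
      (d := fun t => d t ω) (e := fun t => e t ω)
      (A := fun t => ‖Gxbar (xg t ω) (yg t ω) - ug t ω‖)
      (B := fun t => ‖Gybar (xg t ω) (yg t ω) - vg t ω‖) (C := fun t => C t ω)
      (D := fun t => D t ω) hLf hmupl hgammax hGxb hGyb hLb hle hPL' hatt hGPhi
      (fun x => hPhiStar.1 (Set.mem_range_self x)) (fun t => hxstep t ω)
      (fun t => by rw [← hgy]; exact hystep t ω) (fun t => hd1 t ω) (fun t => he1 t ω)
      (fun t => norm_nonneg _) (fun t => norm_nonneg _) (fun t => hC0 t ω) (fun t => hD0 t ω)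
      (le_inner_average_normalized hcard0 (fun q _ => hulnz _ _ _ _) _ _)
      (le_inner_average_normalized hcard0 (fun q _ => hvlnz _ _ _ _) _ _)
      (fun t => le_inner_average_normalized_of_average_eq hcard0 (fun q _ => hulnz _ _ _ _) _
        (huavg t ω))
      (fun t => le_inner_average_normalized_of_average_eq hcard0 (fun q _ => hvlnz _ _ _ _) _
        (hvavg t ω)) hT
    simp only [hx0, hy0] at h1
    linarith
  -- integrability
  have hxmeas : ∀ t, StronglyMeasurable (xg t) := fun t => by
    rw [← hxl0 ⟨0, hN⟩ t]; exact (hiteradapt ⟨0, hN⟩ t 0).1.mono (F.le _)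
  have hymeas : ∀ t, StronglyMeasurable (yg t) := fun t => by
    rw [← hyl0 ⟨0, hN⟩ t]; exact (hiteradapt ⟨0, hN⟩ t 0).2.mono (F.le _)
  have hxdist : ∀ t ω, dist (xg t ω) x0 ≤ t * gammax := fun t ω => by
    have h1 := norm_sub_le_of_norm_step_le (x := fun t => xg t ω) (γ := gammax) (fun t => by
      simp only [hxstep]
      rw [sub_sub_cancel_left, norm_neg, norm_smul, Real.norm_of_nonneg hgammax.le]
      exact mul_le_of_le_one_right hgammax.le (hd1 t ω)) 0 t
    simpa [hx0, dist_eq_norm] using h1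
  have hydist : ∀ t ω, dist (yg t ω) y0 ≤ t * gammay := fun t ω => by
    have h1 := norm_sub_le_of_norm_step_le (x := fun t => yg t ω) (γ := gammay) (fun t => by
      simp only [hystep]
      rw [add_sub_cancel_left, norm_smul, Real.norm_of_nonneg hgammay.le]
      exact mul_le_of_le_one_right hgammay.le (he1 t ω)) 0 t
    simpa [hy0, dist_eq_norm] using h1
  have hzdist : ∀ t ω, dist (xg t ω, yg t ω) (x0, y0) ≤ max (t * gammax) (t * gammay) :=
    fun t ω => max_le_max (hxdist t ω) (hydist t ω)
  have hGPhiInt : ∀ t, Integrable (fun ω => ‖GPhi (xg t ω)‖) μ := fun t => by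
    have hlip : LipschitzWith (Lf * √(1 + (Lf / mupl) ^ 2)).toNNReal GPhi :=
      LipschitzWith.of_dist_le_mul fun x x' => by
        rw [dist_eq_norm, dist_eq_norm, Real.coe_toNNReal _ (by positivity)]
        exact norm_gradient_primal_sub_gradient_primal_le hLf hmupl hGxb hGyb hLb hle hPL' hatt
          hGPhi x x'
    exact (hlip.integrable_comp_of_dist_le (hxmeas t) (hxdist t)).norm
  have hGxInt : ∀ t, Integrable (fun ω => Gxbar (xg t ω) (yg t ω)) μ := fun t =>
    (lipschitzWith_uncurry_of_le_sqrt hLf.le fun x y x' y' => (Real.le_sqrt_of_sq_le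
      (le_add_of_nonneg_right (sq_nonneg _))).trans (hLb x y x' y')).integrable_comp_of_dist_le
      ((hxmeas t).prodMk (hymeas t)) (hzdist t)
  have hGyInt : ∀ t, Integrable (fun ω => Gybar (xg t ω) (yg t ω)) μ := fun t =>
    (lipschitzWith_uncurry_of_le_sqrt hLf.le fun x y x' y' => (Real.le_sqrt_of_sq_le
      (le_add_of_nonneg_left (sq_nonneg _))).trans (hLb x y x' y')).integrable_comp_of_dist_le
      ((hxmeas t).prodMk (hymeas t)) (hzdist t)
  obtain ⟨huinit, hvinit, hgxinit, hgyinit, hgxlinit, hgylinit⟩ := hinitint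
  have hgxlInt : ∀ n t, Integrable (gxl n t) μ := fun n t => by
    rw [hgxl]; exact integrable_smul_sum _ _ fun i => hDxint n t i
  have hgylInt : ∀ n t, Integrable (gyl n t) μ := fun n t => by
    rw [hgyl]; exact integrable_smul_sum _ _ fun i => hDyint n t i
  have hgxgInt : ∀ t, Integrable (gxg t) μ := fun t => by
    rw [hgxg]; exact integrable_smul_sum _ _ fun n => hgxlInt n t
  have hgygInt : ∀ t, Integrable (gyg t) μ := fun t => by
    rw [hgyg]; exact integrable_smul_sum _ _ fun n => hgylInt n t
  have hugInt := integrable_global_momentum hgxgInt huinit hug0 hugS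
  have hvgInt := integrable_global_momentum hgygInt hvinit hvg0 hvgS
  have hulInt : ∀ n t i, Integrable (ul n t i) μ := by
    rintro n (_ | t) i
    · rw [hul0]
      exact ((((hDxint n 0 i).add hgxinit).sub (hgxlinit n)).smul betax).add
        (huinit.smul (1 - betax))
    · rw [hulS]
      exact ((((hDxint n (t + 1) i).add (hgxgInt t)).sub (hgxlInt n t)).smul betax).add
        ((hugInt t).smul (1 - betax))
  have hvlInt : ∀ n t i, Integrable (vl n t i) μ := by
    rintro n (_ | t) i
    · rw [hvl0]
      exact ((((hDyint n 0 i).add hgyinit).sub (hgylinit n)).smul betay).add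
        (hvinit.smul (1 - betay))
    · rw [hvlS]
      exact ((((hDyint n (t + 1) i).add (hgygInt t)).sub (hgylInt n t)).smul betay).add
        ((hvgInt t).smul (1 - betay))
  have huInt : ∀ n t i, Integrable (fun ω => ‖ug t ω - ul n t i ω‖) μ := fun n t i =>
    ((hugInt t).sub (hulInt n t i)).norm
  have hCInt : ∀ t, Integrable (C t) μ := fun t =>
    (integrable_finsetSum S fun q _ => huInt q.1 t q.2).const_mul _
  have hvInt : ∀ n t i, Integrable (fun ω => ‖vg t ω - vl n t i ω‖) μ := fun n t i =>
    ((hvgInt t).sub (hvlInt n t i)).norm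
  have hDInt : ∀ t, Integrable (D t) μ := fun t =>
    (integrable_finsetSum S fun q _ => hvInt q.1 t q.2).const_mul _
  have hCeq : ∀ t, ∫ ω, C t ω ∂μ = (N * p : ℝ)⁻¹ *
      ∑ n, ∑ i ∈ Finset.range p, ∫ ω, ‖ug t ω - ul n t i ω‖ ∂μ := fun t => by
    rw [hC, integral_const_mul, integral_finsetSum S fun q _ =>
      huInt q.1 t q.2, hcard, hS, Finset.sum_product]
  have hDeq : ∀ t, ∫ ω, D t ω ∂μ = (N * p : ℝ)⁻¹ *
      ∑ n, ∑ i ∈ Finset.range p, ∫ ω, ‖vg t ω - vl n t i ω‖ ∂μ := fun t => by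
    rw [hD, integral_const_mul, integral_finsetSum S fun q _ =>
      hvInt q.1 t q.2, hcard, hS, Finset.sum_product]
  have hint := sum_integral_le_of_forall_sum_le hGPhiInt
    (fun t => ((hGxInt t).sub (hugInt t)).norm) (fun t => ((hGyInt t).sub (hvgInt t)).norm)
    hCInt hDInt hpath
  simp only [hCeq, hDeq, ← Finset.mul_sum, Pi.sub_apply] at hint
  rw [one_div_mul_eq_div, div_le_iff₀ hT0]
  refine le_of_mul_le_mul_left (hint.trans_eq ?_) hgammax
  field_simp
  ring
end

section
/- Let (v_t)_{t∈ℕ} be a sequence of integrable random vectors in ℝ^d adapted to a filtration (F_t) with E[v_t | F_{t−1}] = 0 for every t. Then for any s ∈ [1,2] and any T ∈ ℕ, E[‖Σ_{t=1}^{T} v_t‖] ≤ 2√2 · E[(Σ_{t=1}^{T} ‖v_t‖^s)^{1/s}]. -/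
open MeasureTheory

/-- Monotonicity of finite `ℓ^p` norms in the exponent. -/
theorem sum_rpow_rpow_inv_antitone {ι : Type*} (I : Finset ι) (a : ι → ℝ)
    (ha : ∀ i ∈ I, 0 ≤ a i) {p q : ℝ} (hp : 0 < p) (hpq : p ≤ q) :
    (∑ i ∈ I, a i ^ q) ^ (1 / q) ≤ (∑ i ∈ I, a i ^ p) ^ (1 / p) := by
  have hq : 0 < q := hp.trans_le hpq
  have hS : 0 ≤ ∑ i ∈ I, a i ^ p := Finset.sum_nonneg fun i hi => Real.rpow_nonneg (ha i hi) _
  set N := (∑ i ∈ I, a i ^ p) ^ (1 / p) with hN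
  have hN0 : 0 ≤ N := Real.rpow_nonneg hS _
  have hNp : N ^ p = ∑ i ∈ I, a i ^ p := by
    rw [hN, ← Real.rpow_mul hS, one_div_mul_cancel hp.ne', Real.rpow_one]
  have hle : ∀ i ∈ I, a i ≤ N := fun i hi => by
    rw [← Real.rpow_le_rpow_iff (ha i hi) hN0 hp, hNp]
    exact Finset.single_le_sum (f := fun i => a i ^ p)
      (fun j hj => Real.rpow_nonneg (ha j hj) _) hi
  have hsum : ∑ i ∈ I, a i ^ q ≤ N ^ q := by
    have hsplit : ∀ x : ℝ, 0 ≤ x → x ^ q = x ^ p * x ^ (q - p) := fun x hx => by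
      rw [← Real.rpow_add_of_nonneg hx hp.le (sub_nonneg.2 hpq), add_sub_cancel]
    rw [hsplit N hN0, hNp, Finset.sum_mul]
    refine Finset.sum_le_sum fun i hi => ?_
    rw [hsplit _ (ha i hi)]
    exact mul_le_mul_of_nonneg_left
      (Real.rpow_le_rpow (ha i hi) (hle i hi) (sub_nonneg.2 hpq)) (Real.rpow_nonneg (ha i hi) _)
  calc (∑ i ∈ I, a i ^ q) ^ (1 / q) ≤ (N ^ q) ^ (1 / q) :=
        Real.rpow_le_rpow (Finset.sum_nonneg fun i hi => Real.rpow_nonneg (ha i hi) _) hsum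
          (by positivity)
    _ = N := by rw [← Real.rpow_mul hN0, mul_one_div_cancel hq.ne', Real.rpow_one]

section OnlineGradientDescent

variable {E : Type*} [NormedAddCommGroup E] [InnerProductSpace ℝ E]

/-- The metric projection onto the closed unit ball. -/
noncomputable def unitBallProj (y : E) : E := (max 1 ‖y‖)⁻¹ • y

theorem norm_unitBallProj_le (y : E) : ‖unitBallProj y‖ ≤ 1 := by
  have h : 0 < max 1 ‖y‖ := lt_max_of_lt_left one_pos
  rw [unitBallProj, norm_smul, Real.norm_of_nonneg (by positivity), inv_mul_le_iff₀ h, mul_one]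
  exact le_max_right _ _

theorem continuous_unitBallProj : Continuous (unitBallProj : E → E) :=
  ((continuous_const.max continuous_norm).inv₀
    fun _ => (lt_max_of_lt_left one_pos).ne').smul continuous_id

theorem norm_unitBallProj_sub_sq_le (y u : E) (hu : ‖u‖ ≤ 1) :
    ‖unitBallProj y - u‖ ^ 2 ≤ ‖y - u‖ ^ 2 := by
  rcases le_total ‖y‖ 1 with hy | hy
  · simp [unitBallProj, max_eq_left hy]
  · have hpos : 0 < ‖y‖ := one_pos.trans_le hy
    have hin : inner ℝ y u ≤ ‖y‖ := (real_inner_le_norm y u).trans (by nlinarith)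
    have hr : ‖y‖⁻¹ ≤ 1 := inv_le_one_of_one_le₀ hy
    have hri : ‖y‖⁻¹ * ‖y‖ = 1 := inv_mul_cancel₀ hpos.ne'
    rw [unitBallProj, max_eq_right hy, norm_sub_sq_real, norm_sub_sq_real, norm_smul, norm_inv,
      norm_norm, hri, real_inner_smul_left]
    nlinarith [mul_le_mul_of_nonneg_left hin (sub_nonneg.2 hr)]

/-- Projected online gradient ascent on the unit ball for the linear rewards `g 0, g 1, …`, with
the adaptive step sizes `√2 / √(∑ i ≤ n, ‖g i‖²)`. -/
noncomputable def adaptiveAscent (g : ℕ → E) : ℕ → E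
  | 0 => 0
  | n + 1 => unitBallProj
      (adaptiveAscent g n + (√2 / √(∑ i ∈ Finset.range (n + 1), ‖g i‖ ^ 2)) • g n)

theorem norm_adaptiveAscent_le (g : ℕ → E) (n : ℕ) : ‖adaptiveAscent g n‖ ≤ 1 := by
  cases n with
  | zero => simp [adaptiveAscent]
  | succ n => exact norm_unitBallProj_le _

theorem adaptiveAscent_regret_add_le (g : ℕ → E) (u : E) (hu : ‖u‖ ≤ 1) (n : ℕ) :
    ∑ i ∈ Finset.range n, inner ℝ (u - adaptiveAscent g i) (g i)
        + √(∑ i ∈ Finset.range n, ‖g i‖ ^ 2) * ‖adaptiveAscent g n - u‖ ^ 2 / (2 * √2)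
      ≤ 2 * √2 * √(∑ i ∈ Finset.range n, ‖g i‖ ^ 2) := by
  induction n with
  | zero => simp
  | succ n ih =>
    have hS : 0 ≤ ∑ i ∈ Finset.range n, ‖g i‖ ^ 2 := Finset.sum_nonneg fun _ _ => by positivity
    have hS' : 0 ≤ ∑ i ∈ Finset.range (n + 1), ‖g i‖ ^ 2 :=
      Finset.sum_nonneg fun _ _ => by positivity
    have hsucc : √(∑ i ∈ Finset.range (n + 1), ‖g i‖ ^ 2) ^ 2
        = √(∑ i ∈ Finset.range n, ‖g i‖ ^ 2) ^ 2 + ‖g n‖ ^ 2 := by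
      rw [Real.sq_sqrt hS, Real.sq_sqrt hS', Finset.sum_range_succ]
    have hstep := norm_unitBallProj_sub_sq_le
      (adaptiveAscent g n + (√2 / √(∑ i ∈ Finset.range (n + 1), ‖g i‖ ^ 2)) • g n) u hu
    rw [← adaptiveAscent] at hstep
    rw [Finset.sum_range_succ (fun i => inner ℝ (u - adaptiveAscent g i) (g i))]
    have hA := Real.sqrt_nonneg (∑ i ∈ Finset.range n, ‖g i‖ ^ 2)
    have hB := Real.sqrt_nonneg (∑ i ∈ Finset.range (n + 1), ‖g i‖ ^ 2)
    set A := √(∑ i ∈ Finset.range n, ‖g i‖ ^ 2)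
    set B := √(∑ i ∈ Finset.range (n + 1), ‖g i‖ ^ 2)
    set x := adaptiveAscent g n
    have hxu : ‖x - u‖ ^ 2 ≤ 4 := by
      have := (norm_sub_le x u).trans (add_le_add (norm_adaptiveAscent_le g n) hu)
      nlinarith [norm_nonneg (x - u)]
    have h2 : (0 : ℝ) < √2 := by positivity
    have h22 : √2 * √2 = (2 : ℝ) := Real.mul_self_sqrt (by norm_num)
    rcases hB.eq_or_lt with hB0 | hB0
    · have hA0 : A = 0 := by nlinarith [sq_nonneg ‖g n‖]
      have hg0 : g n = 0 := by
        have : ‖g n‖ ^ 2 = 0 := by nlinarith [sq_nonneg ‖g n‖]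
        simpa using this
      rw [hA0] at ih
      rw [← hB0, hg0]
      simpa using ih
    · have hAB : A ≤ B := by nlinarith [sq_nonneg ‖g n‖]
      have hexp : ‖x + (√2 / B) • g n - u‖ ^ 2
          = ‖x - u‖ ^ 2 - 2 * (√2 / B) * inner ℝ (u - x) (g n) + (2 / B ^ 2) * ‖g n‖ ^ 2 := by
        rw [add_sub_right_comm, norm_add_sq_real, norm_smul, real_inner_smul_right,
          Real.norm_of_nonneg (by positivity), ← neg_sub x u, inner_neg_left, mul_pow, div_pow,
          Real.sq_sqrt (by norm_num)]
        ring
      rw [hexp] at hstep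
      have hmul : B * ‖adaptiveAscent g (n + 1) - u‖ ^ 2 / (2 * √2)
          ≤ B * ‖x - u‖ ^ 2 / (2 * √2) - inner ℝ (u - x) (g n)
            + ‖g n‖ ^ 2 / (√2 * B) := by
        calc _ ≤ B * (‖x - u‖ ^ 2 - 2 * (√2 / B) * inner ℝ (u - x) (g n)
                + (2 / B ^ 2) * ‖g n‖ ^ 2) / (2 * √2) := by gcongr
          _ = _ := by field_simp
      have hstable : ‖g n‖ ^ 2 / (√2 * B) ≤ √2 * (B - A) := by
        rw [div_le_iff₀ (by positivity)]
        have : ‖g n‖ ^ 2 = (B - A) * (B + A) := by linarith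
        rw [this, show √2 * (B - A) * (√2 * B) = (√2 * √2) * ((B - A) * B) by ring, h22]
        nlinarith [mul_nonneg (sub_nonneg.2 hAB) (sub_nonneg.2 hAB)]
      have hdiam : B * ‖x - u‖ ^ 2 / (2 * √2) ≤ A * ‖x - u‖ ^ 2 / (2 * √2) + √2 * (B - A) := by
        rw [div_add' _ _ _ (by positivity)]
        gcongr
        rw [show √2 * (B - A) * (2 * √2) = (√2 * √2) * (2 * (B - A)) by ring, h22]
        nlinarith [mul_le_mul_of_nonneg_left hxu (sub_nonneg.2 hAB)]
      linarith

/-- A pathwise bound of a sum by a transform of its increments and its square function. -/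
theorem norm_sum_le_sum_inner_adaptiveAscent_add (g : ℕ → E) (n : ℕ) :
    ‖∑ i ∈ Finset.range n, g i‖ ≤ ∑ i ∈ Finset.range n, inner ℝ (adaptiveAscent g i) (g i)
      + 2 * √2 * √(∑ i ∈ Finset.range n, ‖g i‖ ^ 2) := by
  set M := ∑ i ∈ Finset.range n, g i with hM
  have hu : ‖‖M‖⁻¹ • M‖ ≤ 1 := by
    rw [norm_smul, norm_inv, norm_norm]
    exact inv_mul_le_one
  have hinner : inner ℝ (‖M‖⁻¹ • M) M = ‖M‖ := by
    rw [real_inner_smul_left, real_inner_self_eq_norm_sq]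
    rcases eq_or_ne ‖M‖ 0 with h | h
    · simp [h]
    · field_simp
  have h := adaptiveAscent_regret_add_le g _ hu n
  have hnn : 0 ≤ √(∑ i ∈ Finset.range n, ‖g i‖ ^ 2)
      * ‖adaptiveAscent g n - ‖M‖⁻¹ • M‖ ^ 2 / (2 * √2) := by positivity
  simp only [inner_sub_left, Finset.sum_sub_distrib] at h
  rw [← inner_sum, ← hM, hinner] at h
  linarith

theorem stronglyMeasurable_adaptiveAscent {Ω : Type*} {m : MeasurableSpace Ω} (g : ℕ → Ω → E)
    (n : ℕ) (hg : ∀ i < n, StronglyMeasurable (g i)) :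
    StronglyMeasurable fun ω => adaptiveAscent (fun i => g i ω) n := by
  induction n with
  | zero => exact stronglyMeasurable_const
  | succ n ih =>
    have hsum : StronglyMeasurable fun ω => ∑ i ∈ Finset.range (n + 1), ‖g i ω‖ ^ 2 :=
      Finset.stronglyMeasurable_fun_sum _ fun i hi =>
        (hg i (Finset.mem_range.1 hi)).norm.pow 2
    have hstep : StronglyMeasurable
        fun ω => √2 / √(∑ i ∈ Finset.range (n + 1), ‖g i ω‖ ^ 2) :=
      (measurable_const.div hsum.measurable.sqrt).stronglyMeasurable
    exact continuous_unitBallProj.comp_stronglyMeasurable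
      ((ih fun i hi => hg i (hi.trans n.lt_succ_self)).add (hstep.smul (hg n n.lt_succ_self)))

end OnlineGradientDescent

/-- A bounded predictable transform of a martingale difference is integrable with mean zero. -/
theorem integral_inner_eq_zero_of_condExp_eq_zero {E Ω : Type*} [NormedAddCommGroup E]
    [InnerProductSpace ℝ E] [CompleteSpace E] {m mΩ : MeasurableSpace Ω} {μ : Measure Ω}
    [IsFiniteMeasure μ] (hm : m ≤ mΩ) {x g : Ω → E} (hx : StronglyMeasurable[m] x) (C : ℝ)
    (hxC : ∀ ω, ‖x ω‖ ≤ C) (hg : Integrable g μ) (hg0 : μ[g | m] =ᵐ[μ] 0) :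
    Integrable (fun ω => inner ℝ (x ω) (g ω)) μ ∧ ∫ ω, inner ℝ (x ω) (g ω) ∂μ = 0 := by
  have hi : Integrable (fun ω => inner ℝ (x ω) (g ω)) μ :=
    (innerSL ℝ (E := E)).integrable_of_bilin_of_bdd_left C (hx.mono hm).aestronglyMeasurable
      (ae_of_all _ hxC) hg
  refine ⟨hi, ?_⟩
  have h := condExp_bilin_of_stronglyMeasurable_left (innerSL ℝ (E := E)) hx hi hg
  rw [← integral_condExp hm]
  refine integral_eq_zero_of_ae (h.trans ?_)
  filter_upwards [hg0] with ω hω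
  simp [hω]

/-- martingale moment bound under heavy tails, Liu et al.:
if `(v t)` is an integrable martingale difference sequence in `ℝ^d` adapted to a
filtration `F` (i.e. `E[v t | F (t-1)] = 0` for every `t ≥ 1`), then for any
`s ∈ [1,2]` and any `T`, `E‖∑_{t=1}^T v t‖ ≤ 2√2 E[(∑_{t=1}^T ‖v t‖^s)^{1/s}]`. -/
theorem martingale_moment_bound
    {d : ℕ} {Ω : Type} {mΩ : MeasurableSpace Ω}
    (μ : Measure Ω) [IsProbabilityMeasure μ]
    (F : Filtration ℕ mΩ)
    (v : ℕ → Ω → EuclideanSpace ℝ (Fin d))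
    (hint : ∀ t, Integrable (v t) μ)
    (hadapt : ∀ t, StronglyMeasurable[F t] (v t))
    (hmds : ∀ t, 1 ≤ t → μ[v t | F (t - 1)] =ᵐ[μ] 0)
    (s : ℝ) (hs1 : 1 ≤ s) (hs2 : s ≤ 2) (T : ℕ) :
    ∫ ω, ‖∑ t ∈ Finset.Icc 1 T, v t ω‖ ∂μ ≤
      2 * Real.sqrt 2 * ∫ ω, (∑ t ∈ Finset.Icc 1 T, ‖v t ω‖ ^ s) ^ (1 / s) ∂μ := by
  have hreindex : ∀ {M : Type} [AddCommMonoid M] (f : ℕ → M),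
      ∑ t ∈ Finset.Icc 1 T, f t = ∑ i ∈ Finset.range T, f (i + 1) := fun f => by
    rw [Finset.range_eq_Ico, Finset.sum_Ico_add' f 0 T 1, zero_add]
    rfl
  simp only [hreindex]
  set x : ℕ → Ω → EuclideanSpace ℝ (Fin d) :=
    fun n ω => adaptiveAscent (fun i => v (i + 1) ω) n
  have htransform : ∀ i, Integrable (fun ω => inner ℝ (x i ω) (v (i + 1) ω)) μ ∧
      ∫ ω, inner ℝ (x i ω) (v (i + 1) ω) ∂μ = 0 := fun i =>
    integral_inner_eq_zero_of_condExp_eq_zero (F.le i)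
      (stronglyMeasurable_adaptiveAscent _ i fun j hj => (hadapt (j + 1)).mono (F.mono hj)) 1
      (fun ω => norm_adaptiveAscent_le _ _) (hint (i + 1)) (hmds (i + 1) (by lia))
  have hnorm : Integrable
      (fun ω => (∑ i ∈ Finset.range T, ‖v (i + 1) ω‖ ^ s) ^ (1 / s)) μ := by
    refine (integrable_finsetSum (Finset.range T) fun i _ => (hint (i + 1)).norm).mono' ?_ ?_
    · refine Measurable.aestronglyMeasurable (Measurable.pow_const ?_ _)
      exact Finset.measurable_fun_sum _ fun i _ =>
        (((hadapt (i + 1)).mono (F.le _)).norm.measurable.pow_const s)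
    · refine ae_of_all _ fun ω => ?_
      rw [Real.norm_of_nonneg (by positivity)]
      simpa using sum_rpow_rpow_inv_antitone (Finset.range T) (fun i => ‖v (i + 1) ω‖)
        (fun _ _ => norm_nonneg _) one_pos hs1
  have hpath : ∀ ω, ‖∑ i ∈ Finset.range T, v (i + 1) ω‖
      ≤ ∑ i ∈ Finset.range T, inner ℝ (x i ω) (v (i + 1) ω)
        + 2 * √2 * (∑ i ∈ Finset.range T, ‖v (i + 1) ω‖ ^ s) ^ (1 / s) := fun ω => by
    refine (norm_sum_le_sum_inner_adaptiveAscent_add (fun i => v (i + 1) ω) T).trans ?_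
    gcongr
    simpa [Real.sqrt_eq_rpow] using sum_rpow_rpow_inv_antitone (Finset.range T)
      (fun i => ‖v (i + 1) ω‖) (fun _ _ => norm_nonneg _) (one_pos.trans_le hs1) hs2
  have hsum : Integrable
      (fun ω => ∑ i ∈ Finset.range T, inner ℝ (x i ω) (v (i + 1) ω)) μ :=
    integrable_finsetSum _ fun i _ => (htransform i).1
  calc ∫ ω, ‖∑ i ∈ Finset.range T, v (i + 1) ω‖ ∂μ
      ≤ ∫ ω, (∑ i ∈ Finset.range T, inner ℝ (x i ω) (v (i + 1) ω)
          + 2 * √2 * (∑ i ∈ Finset.range T, ‖v (i + 1) ω‖ ^ s) ^ (1 / s)) ∂μ :=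
        integral_mono (integrable_finsetSum _ fun i _ => hint (i + 1)).norm
          (hsum.add (hnorm.const_mul _)) hpath
    _ = 2 * √2 * ∫ ω, (∑ i ∈ Finset.range T, ‖v (i + 1) ω‖ ^ s) ^ (1 / s) ∂μ := by
        rw [integral_add hsum (hnorm.const_mul _), integral_const_mul,
          integral_finsetSum _ fun i _ => (htransform i).1,
          Finset.sum_eq_zero fun i _ => (htransform i).2, zero_add]
end
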